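/- arXiv:1802.06972 — 3 statements merged into one kernel-verified Lean document; each statement's English description precedes it below -/
import Mathlib

section
/- Let F be a finite field, let V be a nonzero finite-dimensional F-vector space, and let G ≤ GL(V). Suppose G has a nilpotent normal subgroup N that acts absolutely irreducibly on V, meaning: the only N-invariant subspaces of V are 0 and V, and every F-linear endomorphism of V commuting with every element of N is a scalar multiple of the identity. Then the minimal base size of G acting on V satisfies b_V(G) ≤ 13. -/
/-- Gluing local configurations along an invariant family of equivalence relations. -/
theorem exists_asymmetric_of_glue {G X J : Type*} [Group G] [MulAction G X] [MulAction G J]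
    (R : J → X → X → Prop) (hsymm : ∀ j x y, R j x y → R j y x)
    (htrans : ∀ j x y z, R j x y → R j y z → R j x z)
    (hsmul : ∀ (g : G) j x y, R j x y → R (g • j) (g • x) (g • y))
    (hsep : ∀ x y, (∀ j, R j x y) → x = y) (hglue : ∀ f : J → X, ∃ x, ∀ j, R j x (f j))
    (j₀ : J) (hj₀ : ∀ j, ∃ g : G, g • j₀ = j) {s t : ℕ} (e : Fin t → X)
    (he : ∀ a b (g : G), g • j₀ = j₀ → R j₀ (g • e a) (e b) → a = b ∧ ∀ x, R j₀ (g • x) x)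
    (c : Fin s → J → Fin t)
    (hc : ∀ a b (g : G), (∀ j, c b (g • j) = c a j) → a = b ∧ ∀ j : J, g • j = j) :
    ∃ f : Fin s → X, ∀ a b (g : G), g • f a = f b → a = b ∧ ∀ x : X, g • x = x := by
  choose τ hτ using hj₀
  choose f hf using fun a => hglue fun j => τ j • e (c a j)
  have key : ∀ a b (g : G), g • f a = f b → ∀ j,
      R j₀ (((τ (g • j))⁻¹ * g * τ j) • e (c a j)) (e (c b (g • j))) := by
    intro a b g h j
    have h1 := hsmul g _ _ _ (hf a j)
    rw [h] at h1
    have h2 := htrans _ _ _ _ (hsymm _ _ _ h1) (hf b (g • j))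
    have h3 := hsmul (τ (g • j))⁻¹ _ _ _ h2
    rw [inv_smul_smul] at h3
    have h4 : (τ (g • j))⁻¹ • g • j = j₀ := by rw [inv_smul_eq_iff, hτ]
    rw [h4] at h3
    simpa [mul_smul] using h3
  have hfix : ∀ (g : G) j, ((τ (g • j))⁻¹ * g * τ j) • j₀ = j₀ := by
    intro g j
    rw [mul_smul, mul_smul, hτ, inv_smul_eq_iff, hτ]
  refine ⟨f, fun a b g h => ?_⟩
  obtain ⟨hab, hJ⟩ := hc a b g fun j => ((he _ _ _ (hfix g j) (key a b g h j)).1).symm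
  refine ⟨hab, fun x => hsep _ _ fun j => ?_⟩
  have h5 := (he _ _ _ (hfix g j) (key a b g h j)).2 ((τ j)⁻¹ • x)
  have h6 := hsmul (τ j) _ _ _ h5
  rwa [hτ, hJ, mul_smul, mul_smul, smul_inv_smul, smul_inv_smul] at h6

/-- If the points with nontrivial stabilizer are few, there are many regular orbits. -/
theorem exists_asymmetric_of_card {H X : Type*} [Group H] [Finite H] [Finite X] [MulAction H X]
    {t m : ℕ} (hfix : ∀ g : H, (∃ x : X, g • x ≠ x) → Nat.card {x : X // g • x = x} ≤ m)
    (hcard : Nat.card H * (t + m) ≤ Nat.card X) :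
    ∃ f : Fin t → X, ∀ a b (g : H), g • f a = f b → a = b ∧ ∀ x : X, g • x = x := by
  classical
  have := Fintype.ofFinite H
  have := Fintype.ofFinite X
  suffices h : ∀ s ≤ t, ∃ f : Fin s → X, ∀ a b (g : H), g • f a = f b →
      a = b ∧ ∀ x : X, g • x = x from h t le_rfl
  intro s
  induction s with
  | zero => exact fun _ => ⟨Fin.elim0, fun a => a.elim0⟩
  | succ s ih =>
    intro hs
    obtain ⟨f, hf⟩ := ih (by omega)
    let B : Finset X := (Finset.univ : Finset H).biUnion fun g =>
      (Finset.univ.image fun a => g • f a) ∪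
        (if ∃ x : X, g • x ≠ x then Finset.univ.filter fun x : X => g • x = x else ∅)
    have hB : B.card ≤ Nat.card H * (s + m) := by
      rw [Nat.card_eq_fintype_card]
      refine Finset.card_biUnion_le_card_mul _ _ _ fun g _ => ?_
      refine (Finset.card_union_le _ _).trans (Nat.add_le_add ?_ ?_)
      · exact Finset.card_image_le.trans (by simp)
      · split_ifs with h
        · have := hfix g h
          rwa [Nat.card_eq_fintype_card, Fintype.card_subtype] at this
        · simp
    have hlt : B.card < (Finset.univ : Finset X).card := by
      rw [Finset.card_univ, ← Nat.card_eq_fintype_card]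
      refine lt_of_le_of_lt hB (lt_of_lt_of_le ?_ hcard)
      have : 0 < Nat.card H := Nat.card_pos
      exact Nat.mul_lt_mul_of_pos_left (by omega) this
    obtain ⟨x, -, hx⟩ := Finset.exists_mem_notMem_of_card_lt_card hlt
    have hx1 : ∀ (g : H) a, g • f a ≠ x := by
      intro g a h
      exact hx (Finset.mem_biUnion.2 ⟨g, Finset.mem_univ _,
        Finset.mem_union_left _ (Finset.mem_image.2 ⟨a, Finset.mem_univ _, h⟩)⟩)
    have hx2 : ∀ g : H, g • x = x → ∀ y : X, g • y = y := by
      intro g h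
      by_contra! hne
      refine hx (Finset.mem_biUnion.2 ⟨g, Finset.mem_univ _, Finset.mem_union_right _ ?_⟩)
      rw [if_pos hne]
      simpa using h
    refine ⟨Fin.snoc f x, fun a b g => ?_⟩
    refine Fin.lastCases ?_ (fun a => ?_) a <;> refine Fin.lastCases ?_ (fun b => ?_) b
    · simp only [Fin.snoc_last]
      exact fun h => ⟨trivial, hx2 g h⟩
    · simp only [Fin.snoc_last, Fin.snoc_castSucc]
      exact fun h => absurd (by rw [← h, inv_smul_smul]) (hx1 g⁻¹ b)
    · simp only [Fin.snoc_last, Fin.snoc_castSucc]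
      exact fun h => absurd h (hx1 g a)
    · simp only [Fin.snoc_castSucc]
      exact fun h => ⟨congrArg _ (hf a b g h).1, (hf a b g h).2⟩

/-- If `φ` separates the left cosets of `T'` in `T` then `|T| ≤ |S| |T'|`. -/
theorem Subgroup.card_le_mul_of_separates {Γ S : Type*} [Group Γ] [Finite S]
    (T T' : Subgroup Γ) (hle : T' ≤ T) (φ : T → S)
    (h : ∀ g k : T, φ g = φ k → (g : Γ)⁻¹ * k ∈ T') :
    Nat.card T ≤ Nat.card S * Nat.card T' := by
  have h1 : Nat.card (T ⧸ T'.subgroupOf T) ≤ Nat.card S := by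
    refine Nat.card_le_card_of_injective (fun q => φ q.out) fun p q hpq => ?_
    rw [← p.out_eq, ← q.out_eq]
    refine QuotientGroup.eq.2 ?_
    rw [Subgroup.mem_subgroupOf]
    exact h _ _ hpq
  have h2 : Nat.card (T'.subgroupOf T) = Nat.card T' :=
    Nat.card_congr (Subgroup.subgroupOfEquivOfLe hle).toEquiv
  rw [Subgroup.card_eq_card_quotient_mul_card_subgroup (T'.subgroupOf T), h2]
  exact Nat.mul_le_mul_right _ h1

theorem Subgroup.two_mul_card_le_of_lt {Γ : Type*} [Group Γ] {D' D : Subgroup Γ} [Finite D]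
    (h : D' < D) : 2 * Nat.card D' ≤ Nat.card D := by
  have h1 := Subgroup.card_eq_card_quotient_mul_card_subgroup (D'.subgroupOf D)
  have h2 : Nat.card (D'.subgroupOf D) = Nat.card D' :=
    Nat.card_congr (Subgroup.subgroupOfEquivOfLe h.le).toEquiv
  rw [h2] at h1
  have h3 : 1 < Nat.card (D ⧸ D'.subgroupOf D) := by
    have : (D'.subgroupOf D).index ≠ 1 := by
      rw [Ne, Subgroup.index_eq_one, Subgroup.subgroupOf_eq_top]
      exact not_le_of_gt h
    have h0 : (D'.subgroupOf D).index ≠ 0 := Subgroup.index_ne_zero_of_finite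
    change 1 < (D'.subgroupOf D).index
    omega
  rw [h1]
  exact Nat.mul_le_mul_right _ h3

theorem Equiv.Perm.card_invariant_le_aux {Δ : Type*} [Fintype Δ] (σ : Equiv.Perm Δ) (e : Δ → ℕ)
    (t : ℕ) : Nat.card {c : Δ → Fin t // ∀ x, c (σ x) = c x} ≤
      t ^ (Fintype.card Δ - Fintype.card {x // e (σ x) < e x}) := by
  classical
  have h : Function.Injective
      (fun (c : {c : Δ → Fin t // ∀ x, c (σ x) = c x}) (x : {x // ¬ e (σ x) < e x}) => c.1 x) := by
    intro c d hcd
    have key : ∀ n x, e x = n → c.1 x = d.1 x := by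
      intro n
      induction n using Nat.strong_induction_on with
      | _ n ih =>
        intro x hx
        by_cases hlt : e (σ x) < e x
        · rw [← c.2 x, ← d.2 x]
          exact ih _ (hx ▸ hlt) _ rfl
        · exact congrFun hcd ⟨x, hlt⟩
    exact Subtype.ext (funext fun x => key _ x rfl)
  refine (Nat.card_le_card_of_injective _ h).trans ?_
  rw [Nat.card_eq_fintype_card, Fintype.card_fun, Fintype.card_fin, Fintype.card_subtype_compl]

/-- A permutation moving at least half of the points fixes at most `t ^ (3 * k / 4)` colourings. -/
theorem Equiv.Perm.card_invariant_le {Δ : Type*} [Fintype Δ] [DecidableEq Δ] (σ : Equiv.Perm Δ)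
    {t : ℕ} (ht : 0 < t) (hσ : 2 * Fintype.card {x // σ x = x} ≤ Fintype.card Δ) :
    Nat.card {c : Δ → Fin t // ∀ x, c (σ x) = c x} ≤ t ^ (3 * Fintype.card Δ / 4) := by
  let e : Δ → ℕ := fun x => Fintype.equivFin Δ x
  have he : Function.Injective e :=
    fun x y h => (Fintype.equivFin Δ).injective (Fin.val_injective h)
  have h1 := σ.card_invariant_le_aux e t
  have h2 := (σ⁻¹).card_invariant_le_aux e t
  have h3 : Nat.card {c : Δ → Fin t // ∀ x, c (σ⁻¹ x) = c x} =
      Nat.card {c : Δ → Fin t // ∀ x, c (σ x) = c x} := by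
    refine Nat.card_congr (Equiv.subtypeEquivRight fun c => ⟨fun h x => ?_, fun h x => ?_⟩)
    · rw [← h (σ x), Equiv.Perm.inv_def, Equiv.symm_apply_apply]
    · rw [← h (σ⁻¹ x), Equiv.Perm.inv_def, Equiv.apply_symm_apply]
  have h4 : Fintype.card {x // e (σ⁻¹ x) < e x} = Fintype.card {x // e x < e (σ x)} := by
    refine (Fintype.card_congr (σ.subtypeEquiv fun x => ?_)).symm
    rw [Equiv.Perm.inv_def, Equiv.symm_apply_apply]
  have h5 : Fintype.card Δ ≤ Fintype.card {x // e (σ x) < e x} +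
      Fintype.card {x // e x < e (σ x)} + Fintype.card {x // σ x = x} := by
    simp only [Fintype.card_subtype, ← Finset.card_univ (α := Δ)]
    refine le_trans (Finset.card_le_card fun x _ => ?_)
      ((Finset.card_union_le _ _).trans (Nat.add_le_add_right (Finset.card_union_le _ _) _))
    simp only [Finset.mem_union, Finset.mem_filter, Finset.mem_univ, true_and]
    rcases lt_trichotomy (e (σ x)) (e x) with h | h | h
    · exact Or.inl (Or.inl h)
    · exact Or.inr (he h)
    · exact Or.inl (Or.inr h)
  rw [h3, h4] at h2
  by_cases h6 : Fintype.card {x // e x < e (σ x)} ≤ Fintype.card {x // e (σ x) < e x}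
  · exact h1.trans (Nat.pow_le_pow_right ht (by omega))
  · exact h2.trans (Nat.pow_le_pow_right ht (by omega))

section Regular

variable {Δ : Type*} {S Z : Subgroup (Equiv.Perm Δ)}

theorem Equiv.Perm.eq_of_apply_eq_of_comm (htrans : ∀ x y, ∃ z ∈ Z, z x = y)
    (hcomm : ∀ z ∈ Z, ∀ w ∈ Z, z * w = w * z) {z w : Equiv.Perm Δ} (hz : z ∈ Z) (hw : w ∈ Z)
    {x : Δ} (h : z x = w x) : z = w := by
  ext y
  obtain ⟨u, hu, rfl⟩ := htrans x y
  have h1 := congrArg (· x) (hcomm z hz u hu)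
  have h2 := congrArg (· x) (hcomm w hw u hu)
  simp only [Equiv.Perm.mul_apply] at h1 h2
  rw [h1, h2, h]

variable [Fintype Δ]

theorem Equiv.Perm.card_eq_of_comm (htrans : ∀ x y, ∃ z ∈ Z, z x = y)
    (hcomm : ∀ z ∈ Z, ∀ w ∈ Z, z * w = w * z) (x : Δ) : Nat.card Z = Fintype.card Δ := by
  rw [← Nat.card_eq_fintype_card]
  refine Nat.card_congr (Equiv.ofBijective (fun z : Z => (z : Equiv.Perm Δ) x) ⟨?_, ?_⟩)
  · exact fun z w h => Subtype.ext (eq_of_apply_eq_of_comm htrans hcomm z.2 w.2 h)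
  · intro y
    obtain ⟨z, hz, h⟩ := htrans x y
    exact ⟨⟨z, hz⟩, h⟩

theorem Equiv.Perm.two_mul_card_fixed_le [DecidableEq Δ] (htrans : ∀ x y, ∃ z ∈ Z, z x = y)
    (hcomm : ∀ z ∈ Z, ∀ w ∈ Z, z * w = w * z)
    (hnorm : ∀ s ∈ S, ∀ z ∈ Z, s * z * s⁻¹ ∈ Z) {g : Equiv.Perm Δ} (hg : g ∈ S) (hg1 : g ≠ 1) :
    2 * Fintype.card {x // g x = x} ≤ Fintype.card Δ := by
  by_cases hne : ∃ i, g i = i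
  swap
  · have : IsEmpty {x // g x = x} := ⟨fun x => hne ⟨x.1, x.2⟩⟩
    simp
  obtain ⟨i, hi⟩ := hne
  have hi' : g⁻¹ i = i := by rw [Equiv.Perm.inv_eq_iff_eq, hi]
  have hlt : Z ⊓ Subgroup.centralizer {g} < Z := by
    refine lt_of_le_of_ne inf_le_left fun h => hg1 ?_
    ext y
    obtain ⟨z, hz, rfl⟩ := htrans i y
    have h1 : z ∈ Subgroup.centralizer {g} := (h.ge hz).2
    have h2 := congrArg (· i) (Subgroup.mem_centralizer_singleton_iff.1 h1)
    simp only [Equiv.Perm.mul_apply, hi] at h2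
    exact h2.symm
  have h1 := Subgroup.two_mul_card_le_of_lt hlt
  rw [Equiv.Perm.card_eq_of_comm htrans hcomm i] at h1
  refine le_trans (Nat.mul_le_mul_left 2 ?_) h1
  rw [← Nat.card_eq_fintype_card]
  choose z hz hzi using htrans i
  have hc : ∀ x : {x // g x = x}, z x ∈ Z ⊓ Subgroup.centralizer {g} := by
    intro x
    refine ⟨hz _, Subgroup.mem_centralizer_singleton_iff.2 ?_⟩
    have : g * z x * g⁻¹ = z x := by
      refine eq_of_apply_eq_of_comm ?_ hcomm (hnorm g hg _ (hz x)) (hz x) (x := i) ?_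
      · exact fun a b => ⟨z b * (z a)⁻¹, Z.mul_mem (hz b) (Z.inv_mem (hz a)), by
          have : (z a)⁻¹ a = i := by rw [Equiv.Perm.inv_eq_iff_eq, hzi]
          simp [Equiv.Perm.mul_apply, this, hzi]⟩
      · simp only [Equiv.Perm.mul_apply, hi', hzi, x.2]
    rw [mul_inv_eq_iff_eq_mul] at this
    exact this.symm
  refine Nat.card_le_card_of_injective
    (fun x => (⟨z x, hc x⟩ : (Z ⊓ Subgroup.centralizer {g} : Subgroup _))) fun x y hxy => ?_
  have := congrArg (fun w => (w : Equiv.Perm Δ) i) (Subtype.ext_iff.1 hxy)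
  simp only [hzi] at this
  exact Subtype.ext this

theorem Equiv.Perm.card_stabilizer_le (htrans : ∀ x y, ∃ z ∈ Z, z x = y)
    (hcomm : ∀ z ∈ Z, ∀ w ∈ Z, z * w = w * z)
    (hnorm : ∀ s ∈ S, ∀ z ∈ Z, s * z * s⁻¹ ∈ Z) (i : Δ) (j : ℕ) :
    ∀ T ≤ S, (∀ s ∈ T, s i = i) →
      Fintype.card Δ < 2 ^ (j + 1) * Nat.card (Z ⊓ Subgroup.centralizer (T : Set _) : Subgroup _) →
      Nat.card T ≤ Fintype.card Δ ^ j := by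
  have hpos : 0 < Fintype.card Δ := Fintype.card_pos_iff.2 ⟨i⟩
  have htriv : ∀ T ≤ S, (∀ s ∈ T, s i = i) →
      Z ⊓ Subgroup.centralizer (T : Set (Equiv.Perm Δ)) = Z → Nat.card T = 1 := by
    intro T hT hTi h
    rw [Subgroup.card_eq_one, Subgroup.eq_bot_iff_forall]
    intro s hs
    ext y
    obtain ⟨z, hz, rfl⟩ := htrans i y
    have h1 : z ∈ Subgroup.centralizer (T : Set (Equiv.Perm Δ)) := (h.ge hz).2
    have h2 := congrArg (· i) (Subgroup.mem_centralizer_iff.1 h1 s hs)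
    simp only [Equiv.Perm.mul_apply, hTi s hs] at h2
    exact h2
  induction j with
  | zero =>
    intro T hT hTi h
    rw [htriv T hT hTi, pow_zero]
    by_contra hne
    have := Subgroup.two_mul_card_le_of_lt (lt_of_le_of_ne inf_le_left hne)
    rw [Equiv.Perm.card_eq_of_comm htrans hcomm i] at this
    omega
  | succ j ih =>
    intro T hT hTi h
    by_cases hD : Z ⊓ Subgroup.centralizer (T : Set (Equiv.Perm Δ)) = Z
    · rw [htriv T hT hTi hD]
      exact Nat.one_le_pow _ _ hpos
    obtain ⟨z, hz, hzD⟩ := SetLike.exists_of_lt (lt_of_le_of_ne inf_le_left hD)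
    have hlt : Z ⊓ Subgroup.centralizer (T : Set (Equiv.Perm Δ)) < Z ⊓ Subgroup.centralizer
        ((T ⊓ Subgroup.centralizer {z} : Subgroup _) : Set (Equiv.Perm Δ)) := by
      refine lt_of_le_of_ne (inf_le_inf_left _ (Subgroup.centralizer_le inf_le_left)) fun h => ?_
      refine hzD (h ▸ ⟨hz, Subgroup.mem_centralizer_iff.2 fun s hs => ?_⟩)
      exact Subgroup.mem_centralizer_singleton_iff.1 hs.2
    have h1 := Subgroup.two_mul_card_le_of_lt hlt
    have h2 := ih (T ⊓ Subgroup.centralizer {z}) (inf_le_left.trans hT) (fun s hs => hTi s hs.1) (by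
      refine h.trans_le ?_
      rw [pow_succ 2 (j + 1), mul_assoc]
      exact Nat.mul_le_mul_left _ h1)
    have h3 := Subgroup.card_le_mul_of_separates T (T ⊓ Subgroup.centralizer {z}) inf_le_left
      (fun g => (g : Equiv.Perm Δ) (z i)) (by
        intro g k hgk
        refine ⟨T.mul_mem (T.inv_mem g.2) k.2, Subgroup.mem_centralizer_singleton_iff.2 ?_⟩
        have hs : (g : Equiv.Perm Δ)⁻¹ * k ∈ T := T.mul_mem (T.inv_mem g.2) k.2
        set s := (g : Equiv.Perm Δ)⁻¹ * k with hsdef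
        have hsz : s (z i) = z i := by
          rw [hsdef, Equiv.Perm.mul_apply, Equiv.Perm.inv_eq_iff_eq]
          exact hgk.symm
        have hsi : s⁻¹ i = i := hTi _ (T.inv_mem hs)
        have : s * z * s⁻¹ = z := by
          refine eq_of_apply_eq_of_comm htrans hcomm (hnorm s (hT hs) _ hz) hz (x := i) ?_
          simp only [Equiv.Perm.mul_apply, hsi, hsz]
        rwa [mul_inv_eq_iff_eq_mul] at this)
    rw [Nat.card_eq_fintype_card (α := Δ)] at h3
    refine h3.trans ?_
    rw [pow_succ, mul_comm]
    exact Nat.mul_le_mul_right _ h2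

theorem Equiv.Perm.card_le_of_regular (htrans : ∀ x y, ∃ z ∈ Z, z x = y)
    (hcomm : ∀ z ∈ Z, ∀ w ∈ Z, z * w = w * z)
    (hnorm : ∀ s ∈ S, ∀ z ∈ Z, s * z * s⁻¹ ∈ Z) (i : Δ) :
    Nat.card S ≤ Fintype.card Δ ^ (Nat.log 2 (Fintype.card Δ) + 1) := by
  have h1 := Subgroup.card_le_mul_of_separates S
    (S ⊓ MulAction.stabilizer (Equiv.Perm Δ) i) inf_le_left
    (fun g => (g : Equiv.Perm Δ) i) (by
      intro g k hgk
      refine ⟨S.mul_mem (S.inv_mem g.2) k.2, ?_⟩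
      change ((g : Equiv.Perm Δ)⁻¹ * k) i = i
      rw [Equiv.Perm.mul_apply, Equiv.Perm.inv_eq_iff_eq]
      exact hgk.symm)
  rw [Nat.card_eq_fintype_card (α := Δ)] at h1
  rw [pow_succ, mul_comm]
  refine h1.trans (Nat.mul_le_mul_left _ ?_)
  refine Equiv.Perm.card_stabilizer_le htrans hcomm hnorm i _ _ inf_le_left (fun s hs => hs.2) ?_
  refine (Nat.lt_pow_succ_log_self one_lt_two _).trans_le (Nat.le_mul_of_pos_right _ Nat.card_pos)

end Regular

theorem Nat.sq_succ_lt_of_three_le (n : ℕ) (hn : 3 ≤ n) : 2 + 2 * (n + 1) ^ 2 ≤ 5 * 2 ^ n := by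
  induction n, hn using Nat.le_induction with
  | base => norm_num
  | succ n hn ih =>
    rw [pow_succ 2 n]
    nlinarith

theorem Nat.two_mul_pow_log_le {k : ℕ} (hk : 2 ≤ k) :
    2 * k ^ (Nat.log 2 k + 1) ≤ 1024 ^ (k - 3 * k / 4) := by
  have h1 : k < 2 ^ (Nat.log 2 k + 1) := Nat.lt_pow_succ_log_self one_lt_two _
  have h2 : 2 ^ Nat.log 2 k ≤ k := Nat.pow_log_le_self 2 (by omega)
  have h0 : 1 ≤ Nat.log 2 k := Nat.log_pos one_lt_two hk
  set n := Nat.log 2 k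
  calc 2 * k ^ (n + 1) ≤ 2 * (2 ^ (n + 1)) ^ (n + 1) :=
        Nat.mul_le_mul_left _ (Nat.pow_le_pow_left h1.le _)
    _ = 2 ^ (1 + (n + 1) ^ 2) := by rw [← pow_mul, pow_add, pow_one, sq]
    _ ≤ 2 ^ (10 * (k - 3 * k / 4)) := by
        refine Nat.pow_le_pow_right two_pos ?_
        by_cases h3 : 3 ≤ n
        · have := Nat.sq_succ_lt_of_three_le n h3
          omega
        · have : n = 1 ∨ n = 2 := by omega
          rcases this with h | h <;> rw [h] at h2 ⊢ <;> norm_num at h2 ⊢ <;> omega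
    _ = 1024 ^ (k - 3 * k / 4) := by rw [pow_mul]; norm_num

theorem Equiv.Perm.exists_asymmetric_coloring {Δ : Type*} [Fintype Δ] [Nonempty Δ]
    {S Z : Subgroup (Equiv.Perm Δ)} (htrans : ∀ x y, ∃ z ∈ Z, z x = y)
    (hcomm : ∀ z ∈ Z, ∀ w ∈ Z, z * w = w * z) (hnorm : ∀ s ∈ S, ∀ z ∈ Z, s * z * s⁻¹ ∈ Z) :
    ∃ c : Fin 1024 → Δ → Fin 1024, ∀ a b, ∀ g ∈ S, (∀ x, c b (g x) = c a x) → a = b ∧ g = 1 := by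
  classical
  let _ := @arrowAction
  obtain ⟨i⟩ := ‹Nonempty Δ›
  have hk0 : 0 < Fintype.card Δ := Fintype.card_pos_iff.2 ⟨i⟩
  by_cases hk : 2 ≤ Fintype.card Δ
  swap
  · refine ⟨fun a _ => a, fun a b g _ h => ⟨(h i).symm, ?_⟩⟩
    have : Subsingleton Δ := Fintype.card_le_one_iff_subsingleton.1 (by omega)
    exact Subsingleton.elim _ _
  have hS := Equiv.Perm.card_le_of_regular htrans hcomm hnorm i
  have hpow := Nat.two_mul_pow_log_le hk
  obtain ⟨c, hc⟩ := exists_asymmetric_of_card (H := S) (X := Δ → Fin 1024) (t := 1024)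
    (m := 1024 ^ (3 * Fintype.card Δ / 4)) (by
      intro g hg
      have hg1 : (g : Equiv.Perm Δ) ≠ 1 := by
        intro h
        obtain ⟨x, hx⟩ := hg
        have h' : g = 1 := Subtype.ext h
        exact hx (by rw [h', one_smul])
      refine le_trans (le_of_eq ?_) (Equiv.Perm.card_invariant_le (g : Equiv.Perm Δ)⁻¹
        (by norm_num) (Equiv.Perm.two_mul_card_fixed_le htrans hcomm hnorm (S.inv_mem g.2)
          (inv_ne_one.2 hg1)))
      exact Nat.card_congr (Equiv.subtypeEquivRight fun c => funext_iff)) (by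
      rw [Nat.card_eq_fintype_card (α := Δ → Fin 1024), Fintype.card_fun, Fintype.card_fin]
      have h1 : 1024 ≤ 1024 ^ (3 * Fintype.card Δ / 4) :=
        Nat.le_self_pow (by omega) _
      calc Nat.card S * (1024 + 1024 ^ (3 * Fintype.card Δ / 4))
          ≤ Fintype.card Δ ^ (Nat.log 2 (Fintype.card Δ) + 1) *
            (2 * 1024 ^ (3 * Fintype.card Δ / 4)) := Nat.mul_le_mul hS (by omega)
        _ = 2 * Fintype.card Δ ^ (Nat.log 2 (Fintype.card Δ) + 1) *
            1024 ^ (3 * Fintype.card Δ / 4) := by ring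
        _ ≤ 1024 ^ (Fintype.card Δ - 3 * Fintype.card Δ / 4) *
            1024 ^ (3 * Fintype.card Δ / 4) := Nat.mul_le_mul_right _ hpow
        _ = 1024 ^ Fintype.card Δ := by rw [← pow_add]; congr 1; omega)
  refine ⟨c, fun a b g hg h => ?_⟩
  obtain ⟨hab, hx⟩ := hc a b ⟨g, hg⟩ (by
    funext x
    change c a (g⁻¹ x) = c b x
    rw [← h, Equiv.Perm.inv_def, Equiv.apply_symm_apply])
  refine ⟨hab, ?_⟩
  ext x
  let d : Δ → Fin 1024 := fun y => if y = x then 1 else 0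
  have h1 : d (g⁻¹ (g x)) = d (g x) := congrFun (hx d) (g x)
  rw [Equiv.Perm.inv_def, Equiv.symm_apply_apply] at h1
  simpa [d] using h1

/-- The permutations of a subset induced by the elements of a subgroup. -/
def Subgroup.inducedPerm {G I : Type*} [Group G] [MulAction G I] (H : Subgroup G) (p : I → Prop) :
    Subgroup (Equiv.Perm {i // p i}) where
  carrier := {σ | ∃ h ∈ H, ∀ x, (σ x : I) = h • (x : I)}
  one_mem' := ⟨1, H.one_mem, fun x => (one_smul G (x : I)).symm⟩
  mul_mem' := by
    rintro σ τ ⟨h, hh, hσ⟩ ⟨k, hk, hτ⟩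
    exact ⟨h * k, H.mul_mem hh hk, fun x => by rw [Equiv.Perm.mul_apply, hσ, hτ, mul_smul]⟩
  inv_mem' := by
    rintro σ ⟨h, hh, hσ⟩
    refine ⟨h⁻¹, H.inv_mem hh, fun x => ?_⟩
    rw [eq_inv_smul_iff, ← hσ, Equiv.Perm.inv_def, Equiv.apply_symm_apply]

theorem MulAction.exists_asymmetric_coloring_of_abelian {G I J : Type*} [Group G] [Finite I]
    [MulAction G I] [MulAction G J] (Z : Subgroup G) [hZ : Z.Normal]
    (hcomm : ∀ z ∈ Z, ∀ w ∈ Z, ∀ i : I, (z * w) • i = (w * z) • i)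
    (htrans : ∀ i j : I, ∃ g : G, g • i = j)
    (p : I → J) (hp : ∀ (g : G) i, p (g • i) = g • p i) (hsurj : Function.Surjective p) [Nonempty I]
    (hfib : ∀ i j : I, p i = p j ↔ ∃ z ∈ Z, z • i = j)
    (c : Fin 1024 → J → Fin 1024)
    (hc : ∀ a b (g : G), (∀ j, c b (g • j) = c a j) → a = b ∧ ∀ j : J, g • j = j) :
    ∃ c : Fin 1024 → I → Fin 1024, ∀ a b (g : G), (∀ i, c b (g • i) = c a i) →
      a = b ∧ ∀ i : I, g • i = i := by
  classical
  let _ := @arrowAction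
  obtain ⟨i₀⟩ := ‹Nonempty I›
  set j₀ := p i₀ with hj₀
  have := Fintype.ofFinite {i // p i = j₀}
  have : Nonempty {i // p i = j₀} := ⟨⟨i₀, rfl⟩⟩
  let σ (g : G) (hg : g • j₀ = j₀) : Equiv.Perm {i // p i = j₀} :=
    (MulAction.toPerm g).subtypePerm (p := fun i => p i = j₀) fun i => by
      rw [MulAction.toPerm_apply, hp]
      exact ⟨fun h => smul_left_cancel g (h.trans hg.symm), fun h => by rw [h, hg]⟩
  have hZp : ∀ z ∈ Z, ∀ i, p (z • i) = p i := fun z hz i => ((hfib _ _).2 ⟨z, hz, rfl⟩).symm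
  obtain ⟨d, hd⟩ := Equiv.Perm.exists_asymmetric_coloring
    (S := (⊤ : Subgroup G).inducedPerm (fun i => p i = j₀))
    (Z := Z.inducedPerm (fun i => p i = j₀)) (by
      rintro ⟨x, hx⟩ ⟨y, hy⟩
      obtain ⟨z, hz, rfl⟩ := (hfib x y).1 (hx.trans hy.symm)
      exact ⟨σ z (by rw [hj₀, ← hp, hZp z hz]), ⟨z, hz, fun x => rfl⟩, rfl⟩) (by
      rintro s ⟨z, hz, hs⟩ t ⟨w, hw, ht⟩
      ext x
      simp only [Equiv.Perm.mul_apply, hs, ht, ← mul_smul]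
      exact hcomm z hz w hw _) (by
      rintro s ⟨g, -, hs⟩ t ⟨z, hz, ht⟩
      refine ⟨g * z * g⁻¹, hZ.conj_mem z hz g, fun x => ?_⟩
      obtain ⟨y, rfl⟩ := s.surjective x
      simp only [Equiv.Perm.mul_apply, hs, ht, Equiv.Perm.inv_def, Equiv.symm_apply_apply, mul_smul,
        inv_smul_smul])
  obtain ⟨f, hf⟩ := exists_asymmetric_of_glue (G := G) (X := I → Fin 1024) (J := J)
    (fun j x y => ∀ i, p i = j → x i = y i) (fun j x y h i hi => (h i hi).symm)
    (fun j x y z h k i hi => (h i hi).trans (k i hi))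
    (fun g j x y h i hi => h (g⁻¹ • i) (by rw [hp, hi, inv_smul_smul]))
    (fun x y h => funext fun i => h (p i) i rfl)
    (fun f => ⟨fun i => f (p i) i, fun j i hi => by subst hi; rfl⟩)
    j₀ (by
      intro j
      obtain ⟨i, rfl⟩ := hsurj j
      obtain ⟨g, rfl⟩ := htrans i₀ i
      exact ⟨g, (hp g i₀).symm⟩)
    (fun a i => if h : p i = j₀ then d a ⟨i, h⟩ else 0) (by
      intro a b g hg h
      have h1 : ∀ x, d b (σ g hg x) = d a x := by
        intro x
        have h2 := h (g • (x : I)) (by rw [hp, x.2, hg])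
        change (if h : p (g⁻¹ • g • (x : I)) = j₀ then d a ⟨_, h⟩ else 0) = _ at h2
        simp only [inv_smul_smul, x.2, dif_pos, hp, hg] at h2
        exact h2.symm
      obtain ⟨hab, h2⟩ := hd a b _ ⟨g, trivial, fun x => rfl⟩ h1
      refine ⟨hab, fun x i hi => ?_⟩
      change x (g⁻¹ • i) = x i
      have h3 := congrArg Subtype.val (DFunLike.congr_fun h2 (⟨i, hi⟩ : {i // p i = j₀}))
      change g • i = i at h3
      rw [inv_smul_eq_iff.2 h3.symm]) c hc
  refine ⟨f, fun a b g h => ?_⟩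
  obtain ⟨hab, h1⟩ := hf a b g (by
    funext i
    change f a (g⁻¹ • i) = f b i
    rw [← h, smul_inv_smul])
  refine ⟨hab, fun i => ?_⟩
  have h2 : (if g⁻¹ • g • i = i then (1 : Fin 1024) else 0) = if g • i = i then 1 else 0 :=
    congrFun (h1 fun y => if y = i then 1 else 0) (g • i)
  simpa using h2

open scoped commutatorElement

universe u

theorem Subgroup.exists_mem_notMem_commutator_mem {G : Type*} [Group G] (N D A : Subgroup G)
    (hN : Group.IsNilpotent N) (hDN : D ≤ N) (hD : ∀ x ∈ D, ∀ n ∈ N, ⁅x, n⁆ ∈ D)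
    (hDA : ¬ D ≤ A) : ∃ x ∈ D, x ∉ A ∧ ∀ n ∈ N, ⁅x, n⁆ ∈ A := by
  by_contra! hcon
  obtain ⟨m, hm⟩ := (Subgroup.isNilpotent_iff_lowerCentralSeries N).1 hN
  have key : ∀ k ≤ m, D ⊓ N.lowerCentralSeries (m - k) ≤ A := by
    intro k
    induction k with
    | zero => simp [hm]
    | succ k ih =>
      rintro hk x ⟨hxD, hx⟩
      by_contra hxA
      obtain ⟨n, hn, h⟩ := hcon x hxD hxA
      refine h (ih (by omega) ⟨hD x hxD n hn, ?_⟩)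
      have : m - k = m - (k + 1) + 1 := by omega
      rw [this]
      exact Subgroup.commutator_mem_commutator hx hn
  refine hDA fun x hx => key m le_rfl ⟨hx, ?_⟩
  rw [Nat.sub_self]
  exact hDN hx

/-- The elements of `D` whose commutators with `N` lie in `A`. -/
def Subgroup.centralizerModulo {G : Type*} [Group G] (D N A : Subgroup G) [A.Normal] :
    Subgroup G :=
  D ⊓ (Subgroup.centralizer (N.map (QuotientGroup.mk' A))).comap (QuotientGroup.mk' A)

theorem Subgroup.mem_centralizerModulo {G : Type*} [Group G] {D N A : Subgroup G} [A.Normal]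
    {x : G} : x ∈ D.centralizerModulo N A ↔ x ∈ D ∧ ∀ n ∈ N, ⁅x, n⁆ ∈ A := by
  rw [centralizerModulo, Subgroup.mem_inf, Subgroup.mem_comap, Subgroup.mem_centralizer_iff]
  refine and_congr_right fun _ => ⟨fun h n hn => ?_, ?_⟩
  · have := h _ ⟨n, hn, rfl⟩
    rw [← QuotientGroup.eq_one_iff, commutatorElement_def]
    simp only [QuotientGroup.mk'_apply, QuotientGroup.mk_mul, QuotientGroup.mk_inv] at this ⊢
    rw [← this, mul_inv_cancel_right, mul_inv_cancel]
  · rintro h _ ⟨n, hn, rfl⟩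
    have := h n hn
    rw [← QuotientGroup.eq_one_iff, commutatorElement_def] at this
    simp only [QuotientGroup.mk'_apply, QuotientGroup.mk_mul, QuotientGroup.mk_inv] at this ⊢
    rw [mul_inv_eq_one, mul_inv_eq_iff_eq_mul] at this
    exact this.symm

theorem Subgroup.centralizerModulo_normal {G : Type*} [Group G] {D N A : Subgroup G} [hA : A.Normal]
    [hD : D.Normal] [hN : N.Normal] : (D.centralizerModulo N A).Normal := by
  refine ⟨fun x hx g => ?_⟩
  rw [mem_centralizerModulo] at hx ⊢
  refine ⟨hD.conj_mem x hx.1 g, fun n hn => ?_⟩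
  have h1 := hA.conj_mem _ (hx.2 _ (hN.conj_mem n hn g⁻¹)) g
  rw [conjugate_commutatorElement] at h1
  convert h1 using 2
  group

theorem MulAction.exists_asymmetric_coloring_of_nilpotent {G : Type*} [Group G] (N : Subgroup G)
    [hNn : N.Normal] (hN : Group.IsNilpotent N) (k : ℕ) :
    ∀ (I : Type u) [Finite I] [Nonempty I] [MulAction G I], Nat.card I = k →
      (∀ i j : I, ∃ n ∈ N, n • i = j) →
    ∃ c : Fin 1024 → I → Fin 1024, ∀ a b (g : G), (∀ i, c b (g • i) = c a i) →
      a = b ∧ ∀ i : I, g • i = i := by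
  induction k using Nat.strong_induction_on with
  | _ k ih =>
  intro I _ _ _ hk htrans
  by_cases hA : N ≤ (MulAction.toPermHom G I).ker
  · have htriv : ∀ i j : I, i = j := by
      intro i j
      obtain ⟨n, hn, rfl⟩ := htrans i j
      exact (Equiv.Perm.congr_fun (MonoidHom.mem_ker.1 (hA hn)) i).symm
    refine ⟨fun a _ => a, fun a b g h => ⟨(h (Classical.arbitrary I)).symm, fun i => htriv _ _⟩⟩
  obtain ⟨z, hzN, hzA, hz⟩ := Subgroup.exists_mem_notMem_commutator_mem N N
    (MulAction.toPermHom G I).ker hN le_rfl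
    (fun x hx n hn => N.mul_mem (N.mul_mem (N.mul_mem hx hn) (N.inv_mem hx)) (N.inv_mem hn)) hA
  set Z := N.centralizerModulo N (MulAction.toPermHom G I).ker with hZdef
  have hZ : Z.Normal := Subgroup.centralizerModulo_normal
  let J := MulAction.orbitRel.Quotient Z I
  let p : I → J := Quotient.mk _
  have hrel : ∀ i j : I, p i = p j ↔ ∃ z ∈ Z, z • i = j := by
    intro i j
    rw [eq_comm]
    refine Quotient.eq.trans (MulAction.orbitRel_apply.trans ⟨?_, ?_⟩)
    · rintro ⟨z, rfl⟩
      exact ⟨z, z.2, rfl⟩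
    · rintro ⟨z, hz, rfl⟩
      exact ⟨⟨z, hz⟩, rfl⟩
  let act : G → J → J := fun g => Quotient.lift (fun i => p (g • i)) fun i j hij => by
    obtain ⟨z, hz, rfl⟩ := (hrel i j).1 (Quotient.sound hij)
    exact (hrel _ _).2 ⟨g * z * g⁻¹, hZ.conj_mem z hz g, by
      rw [mul_smul, inv_smul_smul, mul_smul]⟩
  let _ : MulAction G J :=
    { smul := act
      one_smul := by
        rintro ⟨i⟩
        exact congrArg p (one_smul G i)
      mul_smul := by
        rintro g h ⟨i⟩
        exact congrArg p (mul_smul g h i) }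
  have hp : ∀ (g : G) i, p (g • i) = g • p i := fun g i => rfl
  have hsurj : Function.Surjective p := Quotient.mk_surjective
  have hcard : Nat.card J < k := by
    rw [← hk]
    have := Fintype.ofFinite I
    have := Fintype.ofFinite J
    rw [Nat.card_eq_fintype_card, Nat.card_eq_fintype_card]
    refine Fintype.card_lt_of_surjective_not_injective p hsurj fun hinj => hzA ?_
    rw [MonoidHom.mem_ker]
    ext i
    exact hinj ((hrel _ _).2 ⟨z⁻¹, Z.inv_mem (Subgroup.mem_centralizerModulo.2 ⟨hzN, hz⟩),
      inv_smul_smul z i⟩)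
  have : Nonempty J := Nonempty.map p inferInstance
  obtain ⟨c, hc⟩ := ih _ hcard J rfl (by
    rintro ⟨i⟩ ⟨j⟩
    obtain ⟨n, hn, rfl⟩ := htrans i j
    exact ⟨n, hn, rfl⟩)
  refine MulAction.exists_asymmetric_coloring_of_abelian Z ?_ (fun i j => ?_) p hp hsurj hrel c hc
  · intro z hz w hw i
    have h1 := (Subgroup.mem_centralizerModulo.1 hz).2 w (Subgroup.mem_centralizerModulo.1 hw).1
    rw [MonoidHom.mem_ker, map_commutatorElement, commutatorElement_eq_one_iff_mul_comm] at h1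
    rw [mul_smul, mul_smul]
    exact Equiv.Perm.congr_fun h1 i
  · obtain ⟨n, -, h⟩ := htrans i j
    exact ⟨n, h⟩

/-- The subgroup `N` acts absolutely irreducibly through the representation `ρ`. -/
structure MonoidHom.IsAbsIrreducibleOn {F V G : Type*} [Field F] [AddCommGroup V] [Module F V]
    [Group G] (ρ : G →* Module.End F V) (N : Subgroup G) : Prop where
  eq_bot_or_eq_top : ∀ W : Submodule F V, (∀ n ∈ N, ∀ w ∈ W, ρ n w ∈ W) → W = ⊥ ∨ W = ⊤
  exists_eq_smul : ∀ f : Module.End F V, (∀ n ∈ N, f * ρ n = ρ n * f) → ∃ c : F, f = c • 1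

/-- There are `1024` tuples of `13` vectors lying in pairwise distinct regular orbits. -/
def MonoidHom.HasRegularTuples {F V G : Type*} [Field F] [AddCommGroup V] [Module F V]
    [Group G] (ρ : G →* Module.End F V) : Prop :=
  ∃ f : Fin 1024 → Fin 13 → V, ∀ a b g, (∀ i, ρ g (f a i) = f b i) → a = b ∧ ρ g = 1

/-- A system of imprimitivity for `ρ`, given by its projections. -/
structure MonoidHom.IsImprimitivitySystem {F V G J : Type*} [Field F] [AddCommGroup V] [Module F V]
    [Group G] [Fintype J] [MulAction G J] (ρ : G →* Module.End F V) (π : J → Module.End F V) :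
    Prop where
  mul_self : ∀ j, π j * π j = π j
  mul_of_ne : ∀ j k, j ≠ k → π j * π k = 0
  sum_eq_one : ∑ j, π j = 1
  mul_eq : ∀ g j, ρ g * π j = π (g • j) * ρ g
  ne_zero : ∀ j, π j ≠ 0

namespace MonoidHom.IsImprimitivitySystem

variable {F V G J : Type*} [Field F] [AddCommGroup V] [Module F V]
    [Group G] [Fintype J] [MulAction G J] {ρ : G →* Module.End F V} {π : J → Module.End F V}
    {N : Subgroup G}

theorem exists_smul_eq (h : ρ.IsImprimitivitySystem π) (hN : ρ.IsAbsIrreducibleOn N) (j k : J) :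
    ∃ n ∈ N, n • j = k := by
  by_contra! hcon
  have hinv : ∀ n ∈ N, (⨆ m : N, LinearMap.range (π (m • j))) ≤
      (⨆ m : N, LinearMap.range (π (m • j))).comap (ρ n) := by
    refine fun n hn => iSup_le fun m => ?_
    rintro _ ⟨v, rfl⟩
    refine Submodule.mem_iSup_of_mem (⟨n, hn⟩ * m) ⟨ρ n v, ?_⟩
    rw [mul_smul]
    exact (LinearMap.congr_fun (h.mul_eq n (m • j)) v).symm
  have hker : (⨆ m : N, LinearMap.range (π (m • j))) ≤ LinearMap.ker (π k) := by
    refine iSup_le fun m => ?_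
    rintro _ ⟨v, rfl⟩
    exact LinearMap.congr_fun (h.mul_of_ne k (m • j) (hcon m m.2).symm) v
  rcases hN.eq_bot_or_eq_top _ fun n hn w hw => hinv n hn hw with h1 | h1
  · have h2 := (iSup_eq_bot.1 h1) 1
    rw [one_smul, LinearMap.range_eq_bot] at h2
    exact h.ne_zero j h2
  · rw [h1, top_le_iff, LinearMap.ker_eq_top] at hker
    exact h.ne_zero k hker

/-- The representation of a point stabilizer on the corresponding block. -/
def blockRep (h : ρ.IsImprimitivitySystem π) (j : J) :
    MulAction.stabilizer G j →* Module.End F (LinearMap.range (π j)) where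
  toFun g := (ρ g).restrict (p := LinearMap.range (π j)) (q := LinearMap.range (π j)) (by
    rintro _ ⟨v, rfl⟩
    have h1 := h.mul_eq (g : G) j
    rw [MulAction.mem_stabilizer_iff.1 g.2] at h1
    exact ⟨ρ g v, (LinearMap.congr_fun h1 v).symm⟩)
  map_one' := by
    ext v
    simp
  map_mul' g k := by
    ext v
    simp

theorem apply_coe (h : ρ.IsImprimitivitySystem π) {j : J} (v : LinearMap.range (π j)) :
    π j v = v := by
  obtain ⟨_, w, rfl⟩ := v
  exact LinearMap.congr_fun (h.mul_self j) w

theorem apply_apply_eq_zero (h : ρ.IsImprimitivitySystem π) {j k : J} (hjk : j ≠ k) (v : V) :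
    π j (π k v) = 0 :=
  LinearMap.congr_fun (h.mul_of_ne j k hjk) v

theorem apply_smul (h : ρ.IsImprimitivitySystem π) (g : G) (j : J) (v : V) :
    π (g • j) (ρ g v) = ρ g (π j v) :=
  (LinearMap.congr_fun (h.mul_eq g j) v).symm

theorem isAbsIrreducibleOn_blockRep (h : ρ.IsImprimitivitySystem π) (hN : ρ.IsAbsIrreducibleOn N)
    (j : J) : (h.blockRep j).IsAbsIrreducibleOn (N.subgroupOf (MulAction.stabilizer G j)) := by
  classical
  refine ⟨fun W hW => ?_, fun f hf => ?_⟩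
  · have hinv : ∀ n ∈ N, (⨆ m : N, (W.map (Submodule.subtype _)).map (ρ m)) ≤
        (⨆ m : N, (W.map (Submodule.subtype _)).map (ρ m)).comap (ρ n) := by
      refine fun n hn => iSup_le fun m => ?_
      rintro _ ⟨v, hv, rfl⟩
      refine Submodule.mem_iSup_of_mem (⟨n, hn⟩ * m) ⟨v, hv, ?_⟩
      simp
    have hcomap : (⨆ m : N, (W.map (Submodule.subtype _)).map (ρ m)) ≤
        (W.map (Submodule.subtype _)).comap (π j) := by
      refine iSup_le fun m => ?_
      rintro _ ⟨_, ⟨w, hw, rfl⟩, rfl⟩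
      have h1 := h.apply_smul m ((m : G)⁻¹ • j) w
      rw [smul_inv_smul] at h1
      by_cases hm : (m : G)⁻¹ • j = j
      · rw [hm, h.apply_coe] at h1
        rw [Submodule.mem_comap, Submodule.subtype_apply, h1]
        exact ⟨_, hW ⟨m, MulAction.mem_stabilizer_iff.2 (eq_inv_smul_iff.1 hm.symm)⟩
          (Subgroup.mem_subgroupOf.2 m.2) w hw, rfl⟩
      · rw [← h.apply_coe w, h.apply_apply_eq_zero hm, map_zero] at h1
        rw [Submodule.mem_comap, Submodule.subtype_apply, ← h.apply_coe w, h1]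
        exact Submodule.zero_mem _
    rcases hN.eq_bot_or_eq_top _ fun n hn w hw => hinv n hn hw with h1 | h1
    · left
      have h2 := (iSup_eq_bot.1 h1) 1
      rw [OneMemClass.coe_one, map_one, Module.End.one_eq_id, Submodule.map_id] at h2
      exact Submodule.map_injective_of_injective Subtype.val_injective
        (h2.trans (Submodule.map_bot _).symm)
    · right
      rw [eq_top_iff]
      rintro v -
      obtain ⟨w, hw, hwv⟩ : (v : V) ∈ W.map (Submodule.subtype _) := by
        rw [← h.apply_coe v]
        exact hcomap (h1 ▸ Submodule.mem_top)
      rwa [← Subtype.ext hwv]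
  · choose n hn hnj using h.exists_smul_eq hN j
    set f₀ : Module.End F V :=
      (Submodule.subtype _) ∘ₗ f ∘ₗ (LinearMap.rangeRestrict (π j)) with hf₀
    have hcomm : ∀ m ∈ N, m • j = j → f₀ * ρ m = ρ m * f₀ := by
      intro m hm hmj
      ext v
      have h1 := LinearMap.congr_fun (hf ⟨m, MulAction.mem_stabilizer_iff.2 hmj⟩
        (Subgroup.mem_subgroupOf.2 hm)) (LinearMap.rangeRestrict (π j) v)
      have h2 := congrArg Subtype.val h1
      refine Eq.trans ?_ h2
      change ((f _ : LinearMap.range (π j)) : V) = ((f _ : LinearMap.range (π j)) : V)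
      congr 2
      refine Subtype.ext ?_
      change π j (ρ m v) = ρ m (π j v)
      conv_lhs => rw [← hmj]
      exact h.apply_smul m j v
    have hconj : ∀ g k : G, g ∈ N → k ∈ N → g • j = k • j →
        ρ g * f₀ * ρ g⁻¹ = ρ k * f₀ * ρ k⁻¹ := by
      intro g k hg hk hgk
      have h1 := hcomm (k⁻¹ * g) (N.mul_mem (N.inv_mem hk) hg) (by
        rw [mul_smul, hgk, inv_smul_smul])
      calc ρ g * f₀ * ρ g⁻¹ = ρ k * (ρ (k⁻¹ * g) * f₀) * ρ g⁻¹ := by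
            rw [← mul_assoc (ρ k), ← map_mul, mul_inv_cancel_left]
        _ = ρ k * f₀ * ρ k⁻¹ := by
            rw [← h1, mul_assoc, mul_assoc, ← map_mul, mul_inv_cancel_right, mul_assoc]
    have hsum : ∀ g ∈ N, (∑ k, ρ (n k) * f₀ * ρ (n k)⁻¹) * ρ g =
        ρ g * ∑ k, ρ (n k) * f₀ * ρ (n k)⁻¹ := by
      intro g hg
      have h1 : ∀ k, ρ (n (g • k)) * f₀ * ρ (n (g • k))⁻¹ * ρ g =
          ρ g * (ρ (n k) * f₀ * ρ (n k)⁻¹) := by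
        intro k
        rw [hconj (n (g • k)) (g * n k) (hn _) (N.mul_mem hg (hn k)) (by rw [mul_smul, hnj, hnj]),
          mul_assoc, ← map_mul, mul_inv_rev, inv_mul_cancel_right, map_mul, mul_assoc, mul_assoc,
          mul_assoc]
      rw [Finset.sum_mul, Finset.mul_sum, ← Finset.sum_congr rfl fun k _ => h1 k]
      exact (Equiv.sum_comp (MulAction.toPerm g) fun k => ρ (n k) * f₀ * ρ (n k)⁻¹ * ρ g).symm
    obtain ⟨c, hc⟩ := hN.exists_eq_smul _ hsum
    refine ⟨c, ?_⟩
    ext v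
    have h1 := congrArg (π j) (LinearMap.congr_fun hc v)
    rw [LinearMap.sum_apply, map_sum, Finset.sum_eq_single j] at h1
    · have h2 : ρ (n j) * f₀ * ρ (n j)⁻¹ = f₀ := by
        rw [hconj (n j) 1 (hn j) N.one_mem (by rw [hnj, one_smul])]
        simp
      rw [h2] at h1
      have h3 : f₀ v = f v := by
        change ((f _ : LinearMap.range (π j)) : V) = _
        congr 2
        exact Subtype.ext (h.apply_coe v)
      rw [h3, h.apply_coe, LinearMap.smul_apply, Module.End.one_apply, map_smul,
        h.apply_coe] at h1
      rw [h1]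
      simp
    · intro k _ hk
      have h2 := h.apply_smul (n k) ((n k)⁻¹ • j) (f₀ (ρ (n k)⁻¹ v))
      rw [smul_inv_smul] at h2
      rw [Module.End.mul_apply, Module.End.mul_apply, h2]
      have h3 : (n k)⁻¹ • j ≠ j := fun h4 => hk (by rw [← hnj k, ← eq_inv_smul_iff, h4])
      have h5 : f₀ (ρ (n k)⁻¹ v) = π j (f₀ (ρ (n k)⁻¹ v)) := (h.apply_coe _).symm
      rw [h5, h.apply_apply_eq_zero h3, map_zero]
    · exact fun hj => absurd (Finset.mem_univ j) hj

theorem finrank_range_lt [FiniteDimensional F V] [Nontrivial J] (h : ρ.IsImprimitivitySystem π)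
    (j : J) : Module.finrank F (LinearMap.range (π j)) < Module.finrank F V := by
  refine Submodule.finrank_lt fun htop => ?_
  obtain ⟨k, hk⟩ := exists_ne j
  refine h.ne_zero k (LinearMap.ext fun v => ?_)
  obtain ⟨w, rfl⟩ := LinearMap.range_eq_top.1 htop v
  exact h.apply_apply_eq_zero hk w

theorem hasRegularTuples (h : ρ.IsImprimitivitySystem π) [N.Normal] (hNn : Group.IsNilpotent N)
    (hN : ρ.IsAbsIrreducibleOn N) (j : J) (hj : (h.blockRep j).HasRegularTuples) :
    ρ.HasRegularTuples := by
  have : Nonempty J := ⟨j⟩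
  obtain ⟨e, he⟩ := hj
  obtain ⟨c, hc⟩ := MulAction.exists_asymmetric_coloring_of_nilpotent N hNn _ J rfl
    (h.exists_smul_eq hN)
  let _ : MulAction G (Fin 13 → V) :=
    { smul := fun g x i => ρ g (x i)
      one_smul := fun x => by
        funext i
        change ρ 1 (x i) = x i
        simp
      mul_smul := fun g k x => by
        funext i
        change ρ (g * k) (x i) = ρ g (ρ k (x i))
        simp }
  have hsum : ∀ v, ∑ k, π k v = v := fun v => by
    rw [← LinearMap.sum_apply, h.sum_eq_one, Module.End.one_apply]
  obtain ⟨f, hf⟩ := exists_asymmetric_of_glue (G := G) (X := Fin 13 → V) (J := J)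
    (fun k x y => ∀ i, π k (x i) = π k (y i)) (fun k x y h i => (h i).symm)
    (fun k x y z h h' i => (h i).trans (h' i))
    (fun g k x y hk i => by
      change π (g • k) (ρ g (x i)) = π (g • k) (ρ g (y i))
      rw [h.apply_smul, h.apply_smul, hk])
    (fun x y hxy => funext fun i => by
      rw [← hsum (x i), ← hsum (y i), Finset.sum_congr rfl fun k _ => hxy k i])
    (fun x => ⟨fun i => ∑ k, π k (x k i), fun k i => by
      rw [map_sum, Finset.sum_eq_single k]
      · exact LinearMap.congr_fun (h.mul_self k) _
      · exact fun l _ hl => h.apply_apply_eq_zero hl.symm _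
      · exact fun hk => absurd (Finset.mem_univ k) hk⟩)
    j (fun k => (h.exists_smul_eq hN j k).imp fun _ hn => hn.2) (fun a i => (e a i : V)) (by
      intro a b g hg hab
      have hgj : ∀ v, π j (ρ g v) = ρ g (π j v) := fun v => by
        conv_lhs => rw [← hg]
        exact h.apply_smul g j v
      obtain ⟨h1, h2⟩ := he a b ⟨g, hg⟩ (fun i => by
        refine Subtype.ext ?_
        have h3 := hab i
        change π j (ρ g (e a i)) = π j (e b i) at h3
        rw [hgj, h.apply_coe, h.apply_coe] at h3
        exact h3)
      refine ⟨h1, fun x i => ?_⟩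
      change π j (ρ g (x i)) = π j (x i)
      rw [hgj]
      exact congrArg Subtype.val (LinearMap.congr_fun h2 ⟨π j (x i), x i, rfl⟩)) c hc
  refine ⟨f, fun a b g hab => ?_⟩
  obtain ⟨h1, h2⟩ := hf a b g (funext hab)
  refine ⟨h1, LinearMap.ext fun v => ?_⟩
  exact congrFun (h2 fun _ => v) 0

end MonoidHom.IsImprimitivitySystem

theorem exists_pow_mul_self_eq {M : Type*} [Monoid M] [Finite M] (x : M) :
    ∃ n, 0 < n ∧ x ^ n * x ^ n = x ^ n := by
  obtain ⟨a, b, hab, h⟩ : ∃ a b : ℕ, a < b ∧ x ^ a = x ^ b := by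
    obtain ⟨a, b, hne, h⟩ := Finite.exists_ne_map_eq_of_infinite (fun n : ℕ => x ^ n)
    rcases lt_or_gt_of_ne hne with hlt | hlt
    · exact ⟨a, b, hlt, h⟩
    · exact ⟨b, a, hlt, h.symm⟩
  obtain ⟨d, rfl⟩ := Nat.exists_eq_add_of_lt hab
  have key : ∀ k, x ^ a = x ^ (a + k * (d + 1)) := by
    intro k
    induction k with
    | zero => simp
    | succ k ih => rw [add_mul, one_mul, ← add_assoc, pow_add, ← ih, ← pow_add, ← add_assoc, ← h]
  refine ⟨(a + 1) * (d + 1), by positivity, ?_⟩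
  have hle : a ≤ (a + 1) * (d + 1) := by nlinarith
  obtain ⟨c, hc⟩ := Nat.exists_eq_add_of_le hle
  calc x ^ ((a + 1) * (d + 1)) * x ^ ((a + 1) * (d + 1))
      = x ^ (a + (a + 1) * (d + 1)) * x ^ c := by
        rw [← pow_add, ← pow_add]
        congr 1
        omega
    _ = x ^ ((a + 1) * (d + 1)) := by rw [← key, ← pow_add, ← hc]

section

variable {F V : Type*} {G : Type*} [Field F] [AddCommGroup V] [Module F V]
    [Group G] {ρ : G →* Module.End F V} {N : Subgroup G} {𝒜 : Subalgebra F (Module.End F V)}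

theorem MonoidHom.IsAbsIrreducibleOn.eq_zero_of_isNilpotent [FiniteDimensional F V] [Nontrivial V]
    (hN : ρ.IsAbsIrreducibleOn N)
    (hcomm : ∀ x ∈ 𝒜, ∀ y ∈ 𝒜, x * y = y * x) (hconj : ∀ g, ∀ x ∈ 𝒜, ρ g * x * ρ g⁻¹ ∈ 𝒜)
    {x : Module.End F V} (hx : x ∈ 𝒜) (hnil : IsNilpotent x) : x = 0 := by
  let U : Submodule F V := ⨅ y : {y // y ∈ 𝒜 ∧ IsNilpotent y}, LinearMap.ker y.1
  have hmemU : ∀ v, v ∈ U ↔ ∀ y ∈ 𝒜, IsNilpotent y → y v = 0 := by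
    intro v
    simp [U, Submodule.mem_iInf]
  have hinv : ∀ g ∈ N, ∀ v ∈ U, ρ g v ∈ U := by
    intro g _ v hv
    rw [hmemU] at hv ⊢
    rintro y hy ⟨k, hk⟩
    have h1 := hv _ (hconj g⁻¹ y hy) ⟨k, by
      have : ∀ k, (ρ g⁻¹ * y * ρ g⁻¹⁻¹) ^ k = ρ g⁻¹ * y ^ k * ρ g⁻¹⁻¹ := by
        intro k
        induction k with
        | zero => rw [pow_zero, pow_zero, mul_one, ← map_mul, mul_inv_cancel, map_one]
        | succ k ih =>
          rw [pow_succ, ih, pow_succ, mul_assoc, ← mul_assoc (ρ g⁻¹⁻¹), ← mul_assoc (ρ g⁻¹⁻¹),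
            ← map_mul, inv_mul_cancel, map_one, one_mul, mul_assoc, mul_assoc, mul_assoc]
      rw [this, hk, mul_zero, zero_mul]⟩
    have h2 := congrArg (ρ g) h1
    rw [inv_inv, Module.End.mul_apply, Module.End.mul_apply, map_zero, ← Module.End.mul_apply,
      ← map_mul, mul_inv_cancel, map_one, Module.End.one_apply] at h2
    exact h2
  let orb (v : V) : Submodule F V := (Subalgebra.toSubmodule 𝒜).map (LinearMap.applyₗ v)
  have hself : ∀ v, v ∈ orb v := fun v => ⟨1, 𝒜.one_mem, rfl⟩
  obtain ⟨v, hv, hmin⟩ : ∃ v : V, v ≠ 0 ∧ ∀ w : V, w ≠ 0 →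
      Module.finrank F (orb v) ≤ Module.finrank F (orb w) := by
    obtain ⟨v, hv, hmin⟩ := exists_minimalFor_of_wellFoundedLT (fun v : V => v ≠ 0)
      (fun v => Module.finrank F (orb v)) (exists_ne 0)
    refine ⟨v, hv, fun w hw => ?_⟩
    by_contra hlt
    exact hlt (hmin hw (le_of_not_ge hlt))
  have hvU : v ∈ U := by
    rw [hmemU]
    intro y hy hynil
    by_contra hne
    have hle : orb (y v) ≤ orb v := by
      rintro _ ⟨z, hz, rfl⟩
      exact ⟨z * y, 𝒜.mul_mem hz hy, rfl⟩
    have heq := Submodule.eq_of_le_of_finrank_le hle (hmin _ hne)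
    obtain ⟨z, hz, hzv⟩ : v ∈ orb (y v) := heq ▸ hself v
    have hzv' : (z * y) v = v := hzv
    obtain ⟨k, hk⟩ := Commute.isNilpotent_mul_left (show Commute z y from hcomm z hz y hy) hynil
    have hpow : ∀ k, ((z * y) ^ k) v = v := by
      intro k
      induction k with
      | zero => rfl
      | succ k ih => rw [pow_succ, Module.End.mul_apply, hzv', ih]
    have := hpow k
    rw [hk] at this
    exact hv this.symm
  rcases hN.eq_bot_or_eq_top U hinv with h | h
  · rw [h] at hvU
    exact absurd hvU hv
  · refine LinearMap.ext fun w => (hmemU w).1 (h ▸ Submodule.mem_top) x hx hnil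

/-- Primitive idempotents of a subalgebra of endomorphisms. -/
def Subalgebra.IsPrimitiveIdempotent (𝒜 : Subalgebra F (Module.End F V)) (e : Module.End F V) :
    Prop :=
  e ∈ 𝒜 ∧ e ≠ 0 ∧ e * e = e ∧ ∀ f ∈ 𝒜, f * f = f → e * f = e ∨ e * f = 0

theorem Subalgebra.IsPrimitiveIdempotent.mul_eq_zero
    (hcomm : ∀ x ∈ 𝒜, ∀ y ∈ 𝒜, x * y = y * x) {e f : Module.End F V}
    (he : 𝒜.IsPrimitiveIdempotent e) (hf : 𝒜.IsPrimitiveIdempotent f) (hne : e ≠ f) :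
    e * f = 0 := by
  rcases he.2.2.2 f hf.1 hf.2.2.1 with h1 | h1
  · rcases hf.2.2.2 e he.1 he.2.2.1 with h2 | h2
    · exact absurd (by rw [← h1, hcomm e he.1 f hf.1, h2]) hne
    · rw [hcomm e he.1 f hf.1, h2]
  · exact h1

variable [FiniteDimensional F V]

theorem Subalgebra.exists_isPrimitiveIdempotent_mul_eq
    (hcomm : ∀ x ∈ 𝒜, ∀ y ∈ 𝒜, x * y = y * x) {e : Module.End F V}
    (he : e ∈ 𝒜) (he0 : e ≠ 0) (hee : e * e = e) :
    ∃ f, 𝒜.IsPrimitiveIdempotent f ∧ f * e = f := by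
  obtain ⟨f, ⟨hf, hf0, hff, hfe⟩, hmin⟩ := exists_minimalFor_of_wellFoundedLT
    (fun f : Module.End F V => f ∈ 𝒜 ∧ f ≠ 0 ∧ f * f = f ∧ f * e = f)
    (fun f => Module.finrank F (LinearMap.range f)) ⟨e, he, he0, hee, hee⟩
  refine ⟨f, ⟨hf, hf0, hff, fun g hg hgg => ?_⟩, hfe⟩
  by_cases h0 : f * g = 0
  · exact Or.inr h0
  left
  have hfg := hcomm f hf g hg
  have hle : LinearMap.range (f * g) ≤ LinearMap.range f := LinearMap.range_comp_le_range g f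
  have h1 := hmin (j := f * g) ⟨𝒜.mul_mem hf hg, h0, by
      rw [mul_assoc, ← mul_assoc g, ← hfg, mul_assoc f g g, hgg, ← mul_assoc, hff], by
      rw [hfg, mul_assoc, hfe]⟩ (Submodule.finrank_mono hle)
  have heq := Submodule.eq_of_le_of_finrank_le hle h1
  refine LinearMap.ext fun v => ?_
  obtain ⟨w, hw⟩ : f v ∈ LinearMap.range (f * g) := heq ▸ LinearMap.mem_range_self f v
  have h2 : (f * g) (f v) = f v := by
    rw [← hw, ← Module.End.mul_apply, mul_assoc, ← mul_assoc g, ← hfg, mul_assoc f g g, hgg,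
      ← mul_assoc, hff]
  rw [hfg]
  rwa [← Module.End.mul_apply, hfg, mul_assoc, hff] at h2

theorem Subalgebra.sum_isPrimitiveIdempotent
    (hcomm : ∀ x ∈ 𝒜, ∀ y ∈ 𝒜, x * y = y * x) [Fintype {e // 𝒜.IsPrimitiveIdempotent e}] :
    ∑ e : {e // 𝒜.IsPrimitiveIdempotent e}, (e : Module.End F V) = 1 := by
  classical
  set s := ∑ e : {e // 𝒜.IsPrimitiveIdempotent e}, (e : Module.End F V)
  have hmul : ∀ e : {e // 𝒜.IsPrimitiveIdempotent e}, (e : Module.End F V) * s = e := by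
    intro e
    rw [Finset.mul_sum, Finset.sum_eq_single e]
    · exact e.2.2.2.1
    · exact fun f _ hf => e.2.mul_eq_zero hcomm f.2 fun h => hf (Subtype.ext h.symm)
    · exact fun h => absurd (Finset.mem_univ e) h
  have hs : s * s = s := by
    conv_lhs => enter [1]
    rw [Finset.sum_mul, Finset.sum_congr rfl fun e _ => hmul e]
  have hsmem : s ∈ 𝒜 := 𝒜.sum_mem fun e _ => e.2.1
  by_contra hne
  obtain ⟨f, hf, hfs⟩ := Subalgebra.exists_isPrimitiveIdempotent_mul_eq hcomm
    (𝒜.sub_mem 𝒜.one_mem hsmem) (sub_ne_zero.2 (Ne.symm hne)) (by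
      rw [mul_sub, sub_mul, sub_mul, hs]
      simp)
  have h1 := hmul ⟨f, hf⟩
  rw [mul_sub, mul_one] at hfs
  rw [show f * s = f from h1, sub_self] at hfs
  exact hf.2.1 hfs.symm

end

theorem MonoidHom.IsAbsIrreducibleOn.exists_inverse_or_exists_isImprimitivitySystem
    {F G : Type*} {V : Type u} [Field F] [Finite F] [AddCommGroup V] [Module F V]
    [FiniteDimensional F V] [Group G] {ρ : G →* Module.End F V} {N : Subgroup G}
    {𝒜 : Subalgebra F (Module.End F V)} [Nontrivial V] (hN : ρ.IsAbsIrreducibleOn N)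
    (hcomm : ∀ x ∈ 𝒜, ∀ y ∈ 𝒜, x * y = y * x) (hconj : ∀ g, ∀ x ∈ 𝒜, ρ g * x * ρ g⁻¹ ∈ 𝒜) :
    (∀ x ∈ 𝒜, x ≠ 0 → ∃ y ∈ 𝒜, x * y = 1) ∨
      ∃ (J : Type u) (_ : Fintype J) (_ : Nontrivial J) (_ : MulAction G J)
        (π : J → Module.End F V), ρ.IsImprimitivitySystem π := by
  have : Finite V := Module.finite_of_finite F
  have : Finite (Module.End F V) := DFunLike.finite _
  have hfin : Fintype {e // 𝒜.IsPrimitiveIdempotent e} := Fintype.ofFinite _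
  have hsum := Subalgebra.sum_isPrimitiveIdempotent hcomm
  by_cases hJ : Nontrivial {e // 𝒜.IsPrimitiveIdempotent e}
  · right
    have hinv : ∀ g (x : Module.End F V), ρ g⁻¹ * (ρ g * x) = x := fun g x => by
      rw [← mul_assoc, ← map_mul, inv_mul_cancel, map_one, one_mul]
    have hconjmul : ∀ g (x y : Module.End F V),
        (ρ g * x * ρ g⁻¹) * (ρ g * y * ρ g⁻¹) = ρ g * (x * y) * ρ g⁻¹ := fun g x y => by
      simp only [mul_assoc, hinv]
    have hinj : ∀ g (x : Module.End F V), ρ g⁻¹ * (ρ g * x * ρ g⁻¹) * ρ g⁻¹⁻¹ = x := fun g x => by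
      rw [mul_assoc (ρ g), hinv, mul_assoc, ← map_mul, mul_inv_cancel, map_one, mul_one]
    have hinj' : ∀ g (x : Module.End F V), ρ g * (ρ g⁻¹ * x * ρ g⁻¹⁻¹) * ρ g⁻¹ = x := fun g x => by
      simpa only [inv_inv] using hinj g⁻¹ x
    have hprim : ∀ g e, 𝒜.IsPrimitiveIdempotent e →
        𝒜.IsPrimitiveIdempotent (ρ g * e * ρ g⁻¹) := by
      rintro g e ⟨h1, h2, h3, h4⟩
      refine ⟨hconj g e h1, fun h => h2 ?_, by rw [hconjmul, h3], fun f hf hff => ?_⟩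
      · rw [← hinj g e, h, mul_zero, zero_mul]
      · have h5 := h4 (ρ g⁻¹ * f * ρ g⁻¹⁻¹) (hconj g⁻¹ f hf) (by rw [hconjmul, hff])
        rw [← hinj' g f, hconjmul]
        refine h5.imp (fun h => by rw [h]) fun h => by rw [h, mul_zero, zero_mul]
    let act : MulAction G {e // 𝒜.IsPrimitiveIdempotent e} :=
      { smul := fun g e => ⟨ρ g * e * ρ g⁻¹, hprim g e e.2⟩
        one_smul := fun e => Subtype.ext (by
          change ρ 1 * (e : Module.End F V) * ρ 1⁻¹ = e
          simp)
        mul_smul := fun g k e => Subtype.ext (by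
          change ρ (g * k) * (e : Module.End F V) * ρ (g * k)⁻¹ = ρ g * (ρ k * e * ρ k⁻¹) * ρ g⁻¹
          simp only [mul_inv_rev, map_mul, mul_assoc]) }
    refine ⟨_, hfin, hJ, act, Subtype.val, fun e => e.2.2.2.1,
      fun e f h => e.2.mul_eq_zero hcomm f.2 fun h' => h (Subtype.ext h'), hsum, fun g e => ?_,
      fun e => e.2.2.1⟩
    change _ = ρ g * (e : Module.End F V) * ρ g⁻¹ * ρ g
    rw [mul_assoc, ← map_mul, inv_mul_cancel, map_one, mul_one]
  · left
    intro x hx hx0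
    obtain ⟨n, hn, hnn⟩ := exists_pow_mul_self_eq x
    have hxn : x ^ n ≠ 0 := fun h => hx0 (hN.eq_zero_of_isNilpotent hcomm hconj hx ⟨n, h⟩)
    have h1 : 𝒜.IsPrimitiveIdempotent 1 := by
      obtain ⟨e, he, -⟩ := Subalgebra.exists_isPrimitiveIdempotent_mul_eq hcomm
        𝒜.one_mem one_ne_zero (one_mul 1)
      have := not_nontrivial_iff_subsingleton.1 hJ
      rwa [← hsum, Fintype.sum_subsingleton
        (fun e : {e // 𝒜.IsPrimitiveIdempotent e} => (e : Module.End F V)) ⟨e, he⟩]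
    rcases h1.2.2.2 _ (𝒜.pow_mem hx n) hnn with h2 | h2
    · rw [one_mul] at h2
      refine ⟨x ^ (n - 1), 𝒜.pow_mem hx _, ?_⟩
      rw [← pow_succ', Nat.sub_add_cancel hn, h2]
    · rw [one_mul] at h2
      exact absurd h2 hxn

/-- The homomorphism `b ↦ ⁅c, b⁆`, when these commutators are central in `B`. -/
def Subgroup.commutatorHom {Γ K : Type*} [Group Γ] [Monoid K] {A B : Subgroup Γ}
    (hcen : ∀ a ∈ A, ∀ b ∈ B, a * b = b * a) (ι : A →* K) {c : Γ} (hc : ∀ b ∈ B, ⁅c, b⁆ ∈ A) :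
    B →* K :=
  ι.comp
    { toFun := fun b => ⟨⁅c, b⁆, hc b b.2⟩
      map_one' := Subtype.ext (by simp)
      map_mul' := fun b b' => Subtype.ext (by
        have h := hcen _ (hc b' b'.2) b b.2
        simp only [commutatorElement_def, Subgroup.coe_mul] at h ⊢
        calc c * (b * b') * c⁻¹ * (b * b' : Γ)⁻¹
            = c * b * c⁻¹ * ((c * b' * c⁻¹ * (b' : Γ)⁻¹) * (b : Γ)⁻¹) := by group
          _ = c * b * c⁻¹ * ((b : Γ)⁻¹ * (c * b' * c⁻¹ * (b' : Γ)⁻¹)) :=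
            congrArg _ (Commute.inv_right (show Commute _ (b : Γ) from h)).eq
          _ = c * b * c⁻¹ * (b : Γ)⁻¹ * (c * b' * c⁻¹ * (b' : Γ)⁻¹) := by group) }

theorem Subgroup.commutatorHom_apply {Γ K : Type*} [Group Γ] [Monoid K] {A B : Subgroup Γ}
    (hcen : ∀ a ∈ A, ∀ b ∈ B, a * b = b * a) (ι : A →* K) {c : Γ} (hc : ∀ b ∈ B, ⁅c, b⁆ ∈ A)
    (b : B) : commutatorHom hcen ι hc b = ι ⟨⁅c, b⁆, hc b b.2⟩ := rfl

theorem conj_eq_of_commutatorElement_eq {Γ : Type*} [Group Γ] {c d b : Γ} (h : ⁅c, b⁆ = ⁅d, b⁆) :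
    c * b * c⁻¹ = d * b * d⁻¹ :=
  mul_right_cancel h

theorem card_monoidHom_le (Q K : Type*) [Group Q] [Finite Q] [Field K] :
    Finite (Q →* K) ∧ Nat.card (Q →* K) ≤ Nat.card Q := by
  have := Fintype.ofFinite Q
  have h := linearIndependent_monoidHom Q K
  have hfin : Finite (Q →* K) := h.finite
  have := Fintype.ofFinite (Q →* K)
  refine ⟨hfin, ?_⟩
  have h1 := h.fintype_card_le_finrank
  rwa [Module.finrank_fintype_fun_eq_card, ← Nat.card_eq_fintype_card,
    ← Nat.card_eq_fintype_card] at h1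

theorem Subgroup.inv_mul_mem_of_conj_eq {Γ : Type*} [Group Γ] {A B : Subgroup Γ}
    (hZ : ∀ b ∈ B, (∀ b' ∈ B, b * b' = b' * b) → b ∈ A) {y z : Γ} (hy : y ∈ B) (hz : z ∈ B)
    (h : ∀ b ∈ B, y * b * y⁻¹ = z * b * z⁻¹) : y⁻¹ * z ∈ A := by
  refine hZ _ (B.mul_mem (B.inv_mem hy) hz) fun b hb => ?_
  have h3 : z * b = y * b * y⁻¹ * z := by
    rw [h b hb]; group
  rw [mul_assoc, h3]
  group

theorem Subgroup.exists_conj_eq_conj {Γ K : Type*} [Group Γ] [Field K] {A B : Subgroup Γ}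
    [Finite B] (hcen : ∀ a ∈ A, ∀ b ∈ B, a * b = b * a)
    (hBB : ∀ b ∈ B, ∀ b' ∈ B, ⁅b, b'⁆ ∈ A)
    (hZ : ∀ b ∈ B, (∀ b' ∈ B, b * b' = b' * b) → b ∈ A)
    (ι : A →* K) (hι : Function.Injective ι) {c : Γ} (hcA : ∀ a ∈ A, c * a = a * c)
    (hcB : ∀ b ∈ B, ⁅c, b⁆ ∈ A) : ∃ b₀ ∈ B, ∀ b ∈ B, c * b * c⁻¹ = b₀ * b * b₀⁻¹ := by
  have hnorm : (A.subgroupOf B).Normal := by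
    refine ⟨fun a ha b => ?_⟩
    rw [Subgroup.mem_subgroupOf] at ha ⊢
    rw [Subgroup.coe_mul, Subgroup.coe_mul, ← hcen _ ha b b.2, Subgroup.coe_inv,
      mul_inv_cancel_right]
    exact ha
  have hyA (y : B) : ∀ a ∈ A, (y : Γ) * a = a * y := fun a ha => (hcen a ha _ y.2).symm
  let χ (d : Γ) (hdA : ∀ a ∈ A, d * a = a * d) (hdB : ∀ b ∈ B, ⁅d, b⁆ ∈ A) :
      B ⧸ A.subgroupOf B →* K :=
    QuotientGroup.lift _ (commutatorHom hcen ι hdB) fun a ha => by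
      rw [MonoidHom.mem_ker, commutatorHom_apply]
      have h : ⁅d, (a : Γ)⁆ = 1 := commutatorElement_eq_one_iff_mul_comm.2 (hdA _ ha)
      simp only [h]
      exact map_one ι
  have hχ : ∀ d hdA hdB d' hdA' hdB', χ d hdA hdB = χ d' hdA' hdB' →
      ∀ b ∈ B, d * b * d⁻¹ = d' * b * d'⁻¹ := by
    intro d hdA hdB d' hdA' hdB' h b hb
    have h1 := DFunLike.congr_fun h (QuotientGroup.mk ⟨b, hb⟩)
    exact conj_eq_of_commutatorElement_eq (congrArg Subtype.val (hι h1))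
  obtain ⟨hfin, hcard⟩ := card_monoidHom_le (B ⧸ A.subgroupOf B) K
  let Φ : B ⧸ A.subgroupOf B → (B ⧸ A.subgroupOf B →* K) := fun y =>
    χ y.out (hyA _) (hBB _ y.out.2)
  have hΦ : Function.Injective Φ := by
    intro y z hyz
    have h := hχ _ (hyA _) (hBB _ y.out.2) _ (hyA _) (hBB _ z.out.2) hyz
    rw [← y.out_eq, ← z.out_eq]
    exact QuotientGroup.eq.2 (inv_mul_mem_of_conj_eq hZ y.out.2 z.out.2 h)
  obtain ⟨y, hy⟩ := ((Nat.bijective_iff_injective_and_card Φ).2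
    ⟨hΦ, le_antisymm (Nat.card_le_card_of_injective Φ hΦ) hcard⟩).2 (χ c hcA hcB)
  exact ⟨y.out, y.out.2, fun b hb => (hχ _ (hyA _) (hBB _ y.out.2) _ hcA hcB hy b hb).symm⟩

theorem Subgroup.inf_centralizer_le_of_maximal {Γ : Type*} [Group Γ]
    {N A E : Subgroup Γ} [E.Normal] (hAE : A ≤ E)
    (hEN : E ≤ N)
    (hA : ∀ a ∈ A, ∀ b ∈ E, a * b = b * a)
    (hmax : ∀ A' : Subgroup Γ, A'.Normal → A' ≤ N → A ≤ A' →
      (∀ a ∈ A', ∀ b ∈ A', a * b = b * a) → A' ≤ A) :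
    E ⊓ Subgroup.centralizer (E : Set Γ) ≤ A :=
  hmax _ inferInstance (inf_le_left.trans hEN)
    (le_inf hAE fun a ha => Subgroup.mem_centralizer_iff.2 fun b hb => (hA a ha b hb).symm)
    fun _ ha _ hb => Subgroup.mem_centralizer_iff.1 hb.2 _ ha.1

theorem Subgroup.commutator_mem_of_maximal_abelian {Γ K : Type*} [Group Γ] [Field K]
    [Finite Γ] {N A : Subgroup Γ} [N.Normal] [A.Normal] (hN : Group.IsNilpotent N) (hAN : A ≤ N)
    (hA : ∀ a ∈ A, ∀ b ∈ A, a * b = b * a)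
    (hmax : ∀ A' : Subgroup Γ, A'.Normal → A' ≤ N → A ≤ A' →
      (∀ a ∈ A', ∀ b ∈ A', a * b = b * a) → A' ≤ A)
    (ι : A →* K) (hι : Function.Injective ι) :
    ∀ c ∈ N ⊓ Subgroup.centralizer (A : Set Γ), ∀ n ∈ N, ⁅c, n⁆ ∈ A := by
  set C := N ⊓ Subgroup.centralizer (A : Set Γ) with hC
  set B := C.centralizerModulo N A with hB
  have hBN : B.Normal := Subgroup.centralizerModulo_normal ..
  have hcenC : ∀ a ∈ A, ∀ b ∈ C, a * b = b * a := fun a ha b hb =>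
    Subgroup.mem_centralizer_iff.1 hb.2 a ha
  have hBC : B ≤ C := fun b hb => (Subgroup.mem_centralizerModulo.1 hb).1
  have hAB : A ≤ B := fun a ha => Subgroup.mem_centralizerModulo.2
    ⟨⟨hAN ha, Subgroup.mem_centralizer_iff.2 fun b hb => hA b hb a ha⟩, fun n _ => by
      rw [commutatorElement_def, mul_assoc, mul_assoc]
      refine A.mul_mem ha ?_
      rw [← mul_assoc]
      exact Subgroup.Normal.conj_mem ‹_› _ (A.inv_mem ha) n⟩
  have hZB : B ⊓ Subgroup.centralizer (B : Set Γ) ≤ A :=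
    Subgroup.inf_centralizer_le_of_maximal hAB (hBC.trans inf_le_left)
      (fun a ha b hb => hcenC a ha b (hBC hb)) hmax
  have hD : C ⊓ Subgroup.centralizer (B : Set Γ) ≤ A := by
    by_contra hDA
    obtain ⟨x, hx, hxA, hxN⟩ := Subgroup.exists_mem_notMem_commutator_mem N _ A hN
      (inf_le_left.trans inf_le_left) (fun x hx n _ => by
        rw [commutatorElement_def, mul_assoc, mul_assoc]
        refine Subgroup.mul_mem _ hx ?_
        rw [← mul_assoc]
        exact Subgroup.Normal.conj_mem inferInstance _ (Subgroup.inv_mem _ hx) n) hDA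
    exact hxA (hZB ⟨Subgroup.mem_centralizerModulo.2 ⟨hx.1, hxN⟩, hx.2⟩)
  intro c hc
  suffices c ∈ B from (Subgroup.mem_centralizerModulo.1 this).2
  obtain ⟨b₀, hb₀, h⟩ := Subgroup.exists_conj_eq_conj (A := A) (B := B)
    (fun a ha b hb => hcenC a ha b (hBC hb))
    (fun b hb b' hb' => (Subgroup.mem_centralizerModulo.1 hb).2 b' (hBC hb').1)
    (fun b hb hb' => hZB ⟨hb, Subgroup.mem_centralizer_iff.2 fun z hz => (hb' z hz).symm⟩)
    ι hι (c := c) (fun a ha => (hcenC a ha c hc).symm) (fun b hb => by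
      rw [← commutatorElement_inv]
      exact A.inv_mem ((Subgroup.mem_centralizerModulo.1 hb).2 c hc.1))
  have h1 : b₀⁻¹ * c ∈ A := hD ⟨C.mul_mem (C.inv_mem (hBC hb₀)) hc,
    Subgroup.mem_centralizer_iff.2 fun b hb => by
      have h2 := h b hb
      rw [mul_inv_eq_iff_eq_mul] at h2
      rw [mul_assoc b₀⁻¹, h2]
      group⟩
  simpa using B.mul_mem hb₀ (hAB h1)

/-- A representation `ρ` over `F` acting semilinearly on a vector space over an extension field `K`,
where the subgroup `A` acts by scalars from `K` and has only `K`-linear maps commuting with it,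
while only scalars from `F` commute with the subgroup `N`. -/
structure MonoidHom.IsSemilinear {G F K V : Type*} [Group G] [Field F] [Field K] [Algebra F K]
    [AddCommGroup V] [Module F V] [Module K V] (ρ : G →* Module.End F V)
    (N A : Subgroup G) (ι : A →* K) (σ : G →* (K ≃ₐ[F] K)) : Prop where
  injective : Function.Injective ρ
  apply_eq_smul : ∀ a v, ρ (a : A) v = ι a • v
  apply_smul : ∀ g k v, ρ g (k • v) = σ g k • ρ g v
  map_smul_of_commute : ∀ f : Module.End F V, (∀ a ∈ A, f * ρ a = ρ a * f) →
    ∀ (k : K) v, f (k • v) = k • f v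
  exists_eq_smul : ∀ f : Module.End F V, (∀ n ∈ N, f * ρ n = ρ n * f) →
    ∃ c : F, f = c • (1 : Module.End F V)

namespace MonoidHom.IsSemilinear

variable {G F K V : Type*} [Group G] [Field F] [Field K] [Algebra F K] [AddCommGroup V]
  [Module F V] [Module K V] {ρ : G →* Module.End F V}
  {N A : Subgroup G} {ι : A →* K} {σ : G →* (K ≃ₐ[F] K)}

theorem apply_inv_apply (ρ : G →* Module.End F V) (g : G) (v : V) : ρ g⁻¹ (ρ g v) = v := by
  rw [← Module.End.mul_apply, ← map_mul, inv_mul_cancel, map_one, Module.End.one_apply]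

theorem injective_ι (h : ρ.IsSemilinear N A ι σ) : Function.Injective ι := fun a b hab =>
  Subtype.ext (h.injective (LinearMap.ext fun v => by
    rw [h.apply_eq_smul, h.apply_eq_smul, hab]))

theorem mem_centralizer (h : ρ.IsSemilinear N A ι σ) {g : G} (hg : σ g = 1) :
    g ∈ Subgroup.centralizer (A : Set G) := by
  refine Subgroup.mem_centralizer_iff.2 fun a ha => h.injective (LinearMap.ext fun v => ?_)
  rw [map_mul, map_mul, Module.End.mul_apply, Module.End.mul_apply, h.apply_eq_smul ⟨a, ha⟩,
    h.apply_eq_smul ⟨a, ha⟩, h.apply_smul, hg, AlgEquiv.one_apply]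

theorem map_smul_of_mem_centralizer (h : ρ.IsSemilinear N A ι σ) {g : G}
    (hg : g ∈ Subgroup.centralizer (A : Set G)) (k : K) (v : V) : ρ g (k • v) = k • ρ g v :=
  h.map_smul_of_commute _ (fun a ha => by
    rw [← map_mul, ← map_mul, Subgroup.mem_centralizer_iff.1 hg a ha]) k v

theorem exists_eq_smul_of_commute [IsScalarTower F K V] [Nontrivial V] [Finite G]
    (h : ρ.IsSemilinear N A ι σ) (hAN : A ≤ N)
    (hA : ∀ a ∈ A, ∀ b ∈ A, a * b = b * a) (x : Module.End F V)
    (hx : ∀ c ∈ N ⊓ Subgroup.centralizer (A : Set G), x * ρ c = ρ c * x) :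
    ∃ k : K, ∀ v, x v = k • v := by
  have hxK := h.map_smul_of_commute x fun a ha => hx a
    ⟨hAN ha, Subgroup.mem_centralizer_iff.2 fun b hb => hA b hb a ha⟩
  let xK : V →ₗ[K] V := { toFun := x, map_add' := map_add x, map_smul' := hxK }
  suffices H : ∀ v, ¬ LinearIndependent K ![v, xK v] by
    obtain ⟨k, hk⟩ := LinearMap.exists_eq_smul_id_of_forall_notLinearIndependent H
    exact ⟨k, fun v => LinearMap.congr_fun hk v⟩
  intro v hv
  have hv0 : v ≠ 0 := hv.ne_zero 0
  obtain ⟨ψ, hψx, hψv⟩ : ∃ ψ : V →ₗ[K] K, ψ (x v) ≠ 0 ∧ Submodule.span K {v} ≤ LinearMap.ker ψ :=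
    Submodule.exists_le_ker_of_notMem fun hxv => by
      obtain ⟨k, hk⟩ := Submodule.mem_span_singleton.1 hxv
      exact (LinearIndependent.pair_iff' hv0).1 hv k hk
  have hψv : ψ v = 0 := hψv (Submodule.mem_span_singleton_self v)
  let S := N.map σ
  have : Finite S := Finite.of_surjective (fun n : N => (⟨σ n, n, n.2, rfl⟩ : S)) fun τ =>
    ⟨⟨_, τ.2.choose_spec.1⟩, Subtype.ext τ.2.choose_spec.2⟩
  have := Fintype.ofFinite S
  choose n hnN hnσ using fun τ : S => τ.2
  let P (g : G) : Module.End F V := ρ g * x * ρ g⁻¹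
  have hP : ∀ g ∈ N, ∀ g' ∈ N, σ g = σ g' → P g = P g' := by
    intro g hg g' hg' hgg
    have h1 := hx (g⁻¹ * g') ⟨N.mul_mem (N.inv_mem hg) hg', h.mem_centralizer (by
      rw [map_mul, map_inv, hgg, inv_mul_cancel])⟩
    have h2 : g' = g * (g⁻¹ * g') := by group
    calc ρ g * x * ρ g⁻¹ = ρ g * (x * ρ (g⁻¹ * g')) * ρ g'⁻¹ := by
          simp only [mul_assoc, ← map_mul, mul_inv_cancel, mul_one]
      _ = ρ g' * x * ρ g'⁻¹ := by
          rw [h1, ← mul_assoc, ← map_mul, ← h2]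
  let T (k : K) : Module.End F V := ∑ τ : S, (τ : K ≃ₐ[F] K) k • P (n τ)
  have hT : ∀ k, ∃ c : F, T k = c • (1 : Module.End F V) := by
    refine fun k => h.exists_eq_smul _ fun m hm => ?_
    rw [Finset.sum_mul, Finset.mul_sum, ← Equiv.sum_comp (Equiv.mulLeft ⟨σ m, m, hm, rfl⟩)]
    refine Finset.sum_congr rfl fun τ _ => ?_
    have h1 : P (n (Equiv.mulLeft ⟨σ m, m, hm, rfl⟩ τ)) = P (m * n τ) :=
      hP _ (hnN _) _ (N.mul_mem hm (hnN _)) (by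
        rw [hnσ, map_mul, hnσ]
        rfl)
    rw [h1]
    ext w
    simp only [P, Module.End.mul_apply, LinearMap.smul_apply, h.apply_smul, Equiv.coe_mulLeft,
      Subgroup.coe_mul, AlgEquiv.mul_apply, mul_inv_rev, map_mul, apply_inv_apply]
  have hli : LinearIndependent K fun (τ : S) (k : K) => (τ : K ≃ₐ[F] K) k :=
    (linearIndependent_monoidHom K K).comp (fun τ : S => ((τ : K ≃ₐ[F] K) : K →* K))
      fun τ τ' hτ => Subtype.ext (AlgEquiv.ext fun k => DFunLike.congr_fun hτ k)
  have h0 := Fintype.linearIndependent_iff.1 hli (fun τ => ψ (P (n τ) v)) (funext fun k => by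
    obtain ⟨c, hc⟩ := hT k
    have h1 := congrArg (fun f : Module.End F V => ψ (f v)) hc
    simp only [T, LinearMap.sum_apply, LinearMap.smul_apply, map_sum, map_smul,
      Module.End.one_apply] at h1
    rw [← algebraMap_smul K c v, map_smul, hψv, smul_zero] at h1
    simp only [Finset.sum_apply, Pi.smul_apply, Pi.zero_apply]
    simpa only [smul_eq_mul, mul_comm] using h1) 1
  refine hψx ?_
  have h1 : P (n 1) = P 1 := hP _ (hnN _) _ N.one_mem (by
    rw [hnσ, map_one]
    rfl)
  simpa [h1, P] using h0

theorem card_quotient_le [FiniteDimensional K V] [Nontrivial V] (h : ρ.IsSemilinear N A ι σ)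
    {C : Subgroup G} [Finite C] (hcen : ∀ a ∈ A, ∀ b ∈ C, a * b = b * a)
    (hCC : ∀ b ∈ C, ∀ b' ∈ C, ⁅b, b'⁆ ∈ A)
    (hZ : ∀ b ∈ C, (∀ b' ∈ C, b * b' = b' * b) → b ∈ A) :
    Nat.card (C ⧸ A.subgroupOf C) ≤ Module.finrank K V ^ 2 := by
  let Q := C ⧸ A.subgroupOf C
  have := Fintype.ofFinite Q
  let R (y : Q) : Module.End K V :=
    { toFun := ρ y.out
      map_add' := map_add _
      map_smul' := h.map_smul_of_mem_centralizer
        (Subgroup.mem_centralizer_iff.2 fun a ha => hcen a ha _ y.out.2) }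
  let χ (y : Q) : C →* K := Subgroup.commutatorHom hcen ι (hCC _ y.out.2)
  have hχ : Function.Injective χ := by
    intro y z hyz
    rw [← y.out_eq, ← z.out_eq]
    refine QuotientGroup.eq.2 (Subgroup.inv_mul_mem_of_conj_eq hZ y.out.2 z.out.2 fun b hb => ?_)
    exact conj_eq_of_commutatorElement_eq
      (congrArg Subtype.val (h.injective_ι (DFunLike.congr_fun hyz ⟨b, hb⟩)))
  have hconj : ∀ y (d : C) v, ρ (d : G)⁻¹ (R y (ρ d v)) = χ y d • R y v := by
    intro y d v
    have h1 : (d : G)⁻¹ * (y.out * d) = ⁅(y.out : G), (d : G)⁆ * y.out := by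
      have h2 := hcen _ (hCC _ y.out.2 _ d.2) _ d.2
      calc (d : G)⁻¹ * (y.out * d) = (d : G)⁻¹ * (⁅(y.out : G), (d : G)⁆ * d) * y.out := by
            rw [commutatorElement_def]; group
        _ = _ := by rw [h2]; group
    change ρ (d : G)⁻¹ (ρ y.out (ρ d v)) = ι ⟨_, hCC _ y.out.2 _ d.2⟩ • ρ y.out v
    rw [← h.apply_eq_smul, ← Module.End.mul_apply, ← Module.End.mul_apply, ← Module.End.mul_apply,
      ← map_mul, ← map_mul, ← map_mul, mul_assoc, h1]
  have hR : LinearIndependent K R := by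
    refine Fintype.linearIndependent_iff.2 fun g hg y => ?_
    obtain ⟨v, hv⟩ := exists_ne (0 : V)
    have hRv : R y v ≠ 0 := fun h0 => hv (by
      rw [← apply_inv_apply ρ y.out v, show ρ y.out v = 0 from h0, map_zero])
    obtain ⟨ψ, hψ, -⟩ := Submodule.exists_le_ker_of_notMem (p := (⊥ : Submodule K V)) (v := R y v)
      (by rwa [Submodule.mem_bot])
    have h0 := Fintype.linearIndependent_iff.1 ((linearIndependent_monoidHom C K).comp χ hχ)
      (fun y => g y * ψ (R y v)) (funext fun d => by
        have h1 := congrArg (fun f : Module.End K V => ψ (ρ (d : G)⁻¹ (f (ρ d v)))) hg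
        simp only [LinearMap.sum_apply, LinearMap.smul_apply, map_sum, map_smul, hconj,
          LinearMap.zero_apply, map_zero, h.map_smul_of_mem_centralizer
          (Subgroup.mem_centralizer_iff.2 fun a ha => hcen a ha _ (C.inv_mem d.2))] at h1
        simp only [Finset.sum_apply, Pi.smul_apply, Pi.zero_apply, Function.comp_apply]
        rw [← h1]
        refine Finset.sum_congr rfl fun y _ => ?_
        simp only [smul_eq_mul]
        ring) y
    exact (mul_eq_zero.1 h0).resolve_right hψ
  have h1 := hR.fintype_card_le_finrank
  rwa [Module.finrank_linearMap, ← pow_two, ← Nat.card_eq_fintype_card] at h1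

/-- The subspace of vectors fixed by `g`. -/
def _root_.MonoidHom.fixedSpace (ρ : G →* Module.End F V) (g : G) : Submodule F V :=
  LinearMap.ker (ρ g - 1)

theorem _root_.MonoidHom.mem_fixedSpace {ρ : G →* Module.End F V} {g : G} {v : V} :
    v ∈ ρ.fixedSpace g ↔ ρ g v = v := by
  rw [fixedSpace, LinearMap.mem_ker, LinearMap.sub_apply, sub_eq_zero, Module.End.one_apply]

theorem _root_.MonoidHom.two_mul_finrank_fixedSpace_le [FiniteDimensional F V]
    (ρ : G →* Module.End F V) (g c : G) : 2 * Module.finrank F (ρ.fixedSpace g) ≤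
      Module.finrank F V + Module.finrank F (ρ.fixedSpace ⁅g, c⁆) := by
  let W := (ρ.fixedSpace g).map (ρ c)
  have h1 : Module.finrank F W = Module.finrank F (ρ.fixedSpace g) :=
    (Submodule.equivMapOfInjective (ρ c) (Function.LeftInverse.injective (apply_inv_apply ρ c))
      _).finrank_eq.symm
  have h2 := Submodule.finrank_sup_add_finrank_inf_eq (ρ.fixedSpace g) W
  have h3 : ρ.fixedSpace g ⊓ W ≤ ρ.fixedSpace ⁅g, c⁆ := by
    rintro _ ⟨h4, w, hw, rfl⟩
    rw [SetLike.mem_coe, mem_fixedSpace] at *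
    rw [commutatorElement_def, map_mul, map_mul, map_mul, Module.End.mul_apply,
      Module.End.mul_apply, Module.End.mul_apply, apply_inv_apply]
    conv_lhs => rw [← hw, apply_inv_apply]
    exact h4
  have h4 := Submodule.finrank_mono h3
  have h5 := Submodule.finrank_le (ρ.fixedSpace g ⊔ W)
  omega

theorem finrank_fixedSpace_eq_zero (h : ρ.IsSemilinear N A ι σ) {g : G} (hg : g ≠ 1) {k : K}
    (hk : ∀ v, ρ g v = k • v) : Module.finrank F (ρ.fixedSpace g) = 0 := by
  have h1 : ρ.fixedSpace g = ⊥ := by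
    refine (Submodule.eq_bot_iff _).2 fun v hv => ?_
    rw [mem_fixedSpace, hk, ← sub_eq_zero] at hv
    have h2 : (k - 1) • v = 0 := by rw [sub_smul, one_smul, hv]
    refine (smul_eq_zero.1 h2).resolve_left fun h3 => hg (h.injective (LinearMap.ext fun v => ?_))
    rw [hk, sub_eq_zero.1 h3, one_smul, map_one, Module.End.one_apply]
  rw [h1, finrank_bot]

theorem four_mul_finrank_fixedSpace_le [IsScalarTower F K V] [Nontrivial V] [Finite G]
    [FiniteDimensional F V] [N.Normal] [A.Normal]
    (h : ρ.IsSemilinear N A ι σ) (hAN : A ≤ N)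
    (hA : ∀ a ∈ A, ∀ b ∈ A, a * b = b * a)
    (hCC : ∀ b ∈ N ⊓ Subgroup.centralizer (A : Set G),
      ∀ b' ∈ N ⊓ Subgroup.centralizer (A : Set G), ⁅b, b'⁆ ∈ A)
    (hZ : ∀ b ∈ N ⊓ Subgroup.centralizer (A : Set G),
      (∀ b' ∈ N ⊓ Subgroup.centralizer (A : Set G), b * b' = b' * b) → b ∈ A) {g : G}
    (hg : g ≠ 1) :
    4 * Module.finrank F (ρ.fixedSpace g) ≤ 3 * Module.finrank F V := by
  set C := N ⊓ Subgroup.centralizer (A : Set G)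
  have hzero : ∀ a ∈ A, a ≠ 1 → Module.finrank F (ρ.fixedSpace a) = 0 := fun a ha ha1 =>
    h.finrank_fixedSpace_eq_zero ha1 (h.apply_eq_smul ⟨a, ha⟩)
  by_cases hgC : ∀ c ∈ C, g * c = c * g
  · obtain ⟨k, hk⟩ := h.exists_eq_smul_of_commute hAN hA (ρ g) fun c hc => by
      rw [← map_mul, hgC c hc, map_mul]
    rw [h.finrank_fixedSpace_eq_zero hg hk]
    omega
  push Not at hgC
  obtain ⟨c, hc, hgc⟩ := hgC
  have hx1 : ⁅g, c⁆ ≠ 1 := fun h1 => hgc (commutatorElement_eq_one_iff_mul_comm.1 h1)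
  have hxC : ⁅g, c⁆ ∈ C := C.mul_mem (Subgroup.Normal.conj_mem inferInstance _ hc g) (C.inv_mem hc)
  have h1 := ρ.two_mul_finrank_fixedSpace_le g c
  by_cases hxA : ⁅g, c⁆ ∈ A
  · have h2 := hzero _ hxA hx1
    omega
  · have h3 : ∃ y ∈ C, ⁅⁅g, c⁆, y⁆ ≠ 1 := by
      by_contra! h3
      exact hxA (hZ _ hxC fun y hy => commutatorElement_eq_one_iff_mul_comm.1 (h3 y hy))
    obtain ⟨y, hy, hy1⟩ := h3
    have h2 := hzero _ (hCC _ hxC y hy) hy1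
    have h4 := ρ.two_mul_finrank_fixedSpace_le ⁅g, c⁆ y
    omega

end MonoidHom.IsSemilinear

/-- The solution of `b m = q * m * b (m / 2)` for `2 ≤ m`, starting from `b 0 = b 1 = 1`. -/
def halvingProduct (q : ℕ) : ℕ → ℕ
  | 0 => 1
  | 1 => 1
  | m + 2 => q * (m + 2) * halvingProduct q ((m + 2) / 2)

theorem halvingProduct_of_two_le (q : ℕ) {m : ℕ} (hm : 2 ≤ m) :
    halvingProduct q m = q * m * halvingProduct q (m / 2) := by
  obtain ⟨m, rfl⟩ := Nat.exists_eq_add_of_le' hm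
  rw [halvingProduct]

theorem one_le_halvingProduct {q : ℕ} (hq : 1 ≤ q) (m : ℕ) : 1 ≤ halvingProduct q m := by
  induction m using Nat.strong_induction_on with
  | _ m ih =>
    obtain hm | hm := lt_or_ge m 2
    · interval_cases m <;> simp [halvingProduct]
    · rw [halvingProduct_of_two_le q hm]
      exact Nat.mul_pos (by positivity) (ih _ (by omega))

theorem halvingProduct_mono {q : ℕ} (hq : 1 ≤ q) : Monotone (halvingProduct q) := by
  intro k m
  induction m using Nat.strong_induction_on generalizing k with
  | _ m ih =>
    intro hkm
    obtain hk | hk := lt_or_ge k 2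
    · have h1 : halvingProduct q k = 1 := by interval_cases k <;> simp [halvingProduct]
      exact h1.trans_le (one_le_halvingProduct hq m)
    · rw [halvingProduct_of_two_le q hk, halvingProduct_of_two_le q (hk.trans hkm)]
      exact Nat.mul_le_mul (Nat.mul_le_mul_left _ hkm) (ih _ (by omega) (by omega))

theorem Subgroup.card_centralizer_inf_le {Γ K : Type*} [Group Γ] [Finite Γ] [Field K] [Finite K]
    {A C : Subgroup Γ} [C.Normal] (hAC : A ≤ C)
    (hcen : ∀ a ∈ A, ∀ b ∈ C, a * b = b * a)
    (hCC : ∀ b ∈ C, ∀ b' ∈ C, ⁅b, b'⁆ ∈ A)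
    (hZ : ∀ b ∈ C, (∀ b' ∈ C, b * b' = b' * b) → b ∈ A)
    (ι : A →* K) (hι : Function.Injective ι)
    (hscalar : Nat.card (centralizer (C : Set Γ)) ≤ Nat.card K) (m : ℕ) :
    ∀ X : Set Γ, X ⊆ C → Nat.card (C ⊓ centralizer X : Subgroup Γ) ≤ m * Nat.card A →
      Nat.card (centralizer (A : Set Γ) ⊓ centralizer X : Subgroup Γ) ≤
        Nat.card K * halvingProduct (Nat.card K) m := by
  have hK : 1 ≤ Nat.card K := Nat.card_pos
  have hAK : Nat.card A ≤ Nat.card K := Nat.card_le_card_of_injective ι hι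
  induction m using Nat.strong_induction_on with
  | _ m ih =>
    intro X hX hm
    set D := C ⊓ centralizer X with hD
    have hAD : A ≤ D := fun a ha => ⟨hAC ha, mem_centralizer_iff.2 fun x hx =>
      (hcen a ha x (hX hx)).symm⟩
    by_cases hDA : D ≤ A
    · set B := closure X ⊔ A with hB
      have hBC : B ≤ C := sup_le ((closure_le _).2 hX) hAC
      have hDB : ∀ c ∈ C, (∀ b ∈ B, c * b = b * c) → c ∈ A := fun c hc hcB =>
        hDA ⟨hc, mem_centralizer_iff.2 fun x hx =>
          (hcB x ((le_sup_left : _ ≤ B) (subset_closure hx))).symm⟩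
      have hCB : C ≤ B := by
        intro c hc
        obtain ⟨b₀, hb₀, h⟩ := exists_conj_eq_conj (A := A) (B := B)
          (fun a ha b hb => hcen a ha b (hBC hb)) (fun b hb b' hb' => hCC b (hBC hb) b' (hBC hb'))
          (fun b hb => hDB b (hBC hb)) ι hι (c := c) (fun a ha => (hcen a ha c hc).symm)
          (fun b hb => hCC c hc b (hBC hb))
        have h1 : b₀⁻¹ * c ∈ A := hDB _ (C.mul_mem (C.inv_mem (hBC hb₀)) hc) fun b hb => by
          have h2 := h b hb
          rw [mul_inv_eq_iff_eq_mul] at h2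
          rw [mul_assoc b₀⁻¹, h2]
          group
        simpa using B.mul_mem hb₀ ((le_sup_right : _ ≤ B) h1)
      have h1 : centralizer (A : Set Γ) ⊓ centralizer X ≤ centralizer (C : Set Γ) := by
        refine le_trans ?_ (centralizer_le hCB)
        rw [le_centralizer_iff, hB, sup_le_iff, closure_le]
        exact ⟨fun x hx => mem_centralizer_iff.2 fun g hg =>
          (mem_centralizer_iff.1 hg.2 x hx).symm, fun x hx => mem_centralizer_iff.2 fun g hg =>
          (mem_centralizer_iff.1 hg.1 x hx).symm⟩
      exact (Subgroup.card_le_of_le h1).trans (hscalar.trans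
        (Nat.le_mul_of_pos_right _ (one_le_halvingProduct hK m)))
    · obtain ⟨x, hxC, hx⟩ : ∃ x ∈ C, ∃ d ∈ D, d * x ≠ x * d := by
        by_contra! h
        exact hDA fun d hd => hZ d hd.1 fun x hx => h x hx d hd
      obtain ⟨d, hd, hdx⟩ := hx
      have hD' : C ⊓ centralizer (insert x X) < D := by
        refine SetLike.lt_iff_le_and_exists.2
          ⟨inf_le_inf_left _ (centralizer_le (Set.subset_insert _ _)), d, hd, fun h => hdx ?_⟩
        exact (mem_centralizer_iff.1 h.2 x (Set.mem_insert _ _)).symm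
      have hcard := two_mul_card_le_of_lt hD'
      have hAD' : A ≤ C ⊓ centralizer (insert x X) := fun a ha => ⟨hAC ha,
        mem_centralizer_iff.2 fun y hy => (hcen a ha y (by
          obtain rfl | hy := hy
          · exact hxC
          · exact hX hy)).symm⟩
      obtain ⟨k, hk⟩ := card_dvd_of_le hAD'
      have hA0 : 0 < Nat.card A := Nat.card_pos
      have hkm : 2 * k ≤ m := by
        refine Nat.le_of_mul_le_mul_right (c := Nat.card A) ?_ hA0
        calc 2 * k * Nat.card A = 2 * (Nat.card A * k) := by ring
          _ ≤ m * Nat.card A := by rw [← hk]; exact hcard.trans hm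
      have hk0 : k ≠ 0 := by
        rintro rfl
        rw [mul_zero] at hk
        exact Nat.card_pos.ne' hk
      have hT := ih (m / 2) (by omega) (insert x X) (Set.insert_subset hxC hX) (by
        rw [hk, mul_comm]
        exact Nat.mul_le_mul_right _ (by omega))
      have hmem : ∀ g ∈ centralizer (A : Set Γ) ⊓ centralizer X, ⁅g, x⁆ ∈ D := by
        intro g hg
        refine ⟨C.mul_mem (Subgroup.Normal.conj_mem inferInstance _ hxC g) (C.inv_mem hxC),
          mem_centralizer_iff.2 fun y hy => ?_⟩
        have hgy := mem_centralizer_iff.1 hg.2 y hy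
        have ha := hCC y (hX hy) x hxC
        have hga := mem_centralizer_iff.1 hg.1 _ ha
        have hax := hcen _ ha _ (C.mul_mem (Subgroup.Normal.conj_mem inferInstance _ hxC g)
          (C.inv_mem hxC))
        have hyg : y * g⁻¹ = g⁻¹ * y := (Commute.inv_right (show Commute y g from hgy)).eq
        have hyx : y * x⁻¹ = x⁻¹ * ⁅y, x⁆⁻¹ * y := by rw [commutatorElement_def]; group
        calc y * (g * x * g⁻¹ * x⁻¹) = (y * g) * x * g⁻¹ * x⁻¹ := by group
          _ = g * ⁅y, x⁆ * x * (y * g⁻¹) * x⁻¹ := by rw [hgy, commutatorElement_def]; group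
          _ = (g * ⁅y, x⁆) * x * g⁻¹ * (y * x⁻¹) := by rw [hyg]; group
          _ = ⁅y, x⁆ * (g * x * g⁻¹ * x⁻¹) * ⁅y, x⁆⁻¹ * y := by rw [← hga, hyx]; group
          _ = g * x * g⁻¹ * x⁻¹ * y := by rw [hax, mul_inv_cancel_right]
      have h1 := card_le_mul_of_separates _ _ (inf_le_inf_left (centralizer (A : Set Γ))
        (centralizer_le (Set.subset_insert x X)))
        (fun g : (centralizer (A : Set Γ) ⊓ centralizer X : Subgroup Γ) =>
          (⟨⁅(g : Γ), x⁆, hmem g g.2⟩ : D)) (fun g k hgk => by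
          refine ⟨Subgroup.mul_mem _ (Subgroup.inv_mem _ g.2.1) k.2.1, mem_centralizer_iff.2 ?_⟩
          rintro y (rfl | hy)
          · have h2 := conj_eq_of_commutatorElement_eq
              (c := (g : Γ)) (d := k) (congrArg Subtype.val hgk)
            rw [mul_inv_eq_iff_eq_mul] at h2
            rw [← mul_left_cancel_iff (a := (g : Γ)), ← mul_assoc, h2]
            group
          · exact mem_centralizer_iff.1 (Subgroup.mul_mem _ (Subgroup.inv_mem _ g.2.2) k.2.2) y hy)
      rw [halvingProduct_of_two_le _ (by omega)]
      calc _ ≤ Nat.card D * _ := h1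
        _ ≤ (m * Nat.card K) * (Nat.card K * halvingProduct (Nat.card K) (m / 2)) :=
          Nat.mul_le_mul (hm.trans (Nat.mul_le_mul_left _ hAK)) hT
        _ = _ := by ring

theorem mul_add_le_of_pow_four_le {Γ Y m : ℕ} (h1 : 8192 * Γ ≤ Y) (h2 : 2 * Γ ^ 4 ≤ Y)
    (hm : m ^ 4 ≤ Y ^ 3) : Γ * (1024 + m) ≤ Y := by
  have h3 : 8 * (Γ * m) ≤ 7 * Y := by
    refine le_of_pow_le_pow_left₀ (n := 4) (by norm_num) (by positivity) ?_
    calc (8 * (Γ * m)) ^ 4 = 2048 * (2 * Γ ^ 4) * m ^ 4 := by ring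
      _ ≤ 2048 * Y * Y ^ 3 := by gcongr
      _ ≤ (7 * Y) ^ 4 := by
        rw [mul_pow, mul_assoc, ← pow_succ']
        exact Nat.mul_le_mul_right _ (by norm_num)
  rw [mul_add]
  omega

theorem halvingProduct_sq_le {q : ℕ} (hq : 1 ≤ q) (L : ℕ) : ∀ m < 2 ^ (L + 1),
    halvingProduct q m ^ 2 ≤ q ^ (2 * L) * 2 ^ (L * (L + 3)) := by
  induction L with
  | zero =>
    intro m hm
    interval_cases m <;> simp [halvingProduct]
  | succ L ih =>
    intro m hm
    obtain h | h := lt_or_ge m 2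
    · have h1 : halvingProduct q m = 1 := by interval_cases m <;> simp [halvingProduct]
      rw [h1]
      exact Nat.mul_pos (by positivity) (by positivity)
    · rw [halvingProduct_of_two_le q h]
      calc (q * m * halvingProduct q (m / 2)) ^ 2
          = q ^ 2 * m ^ 2 * halvingProduct q (m / 2) ^ 2 := by ring
        _ ≤ q ^ 2 * (2 ^ (L + 2)) ^ 2 * (q ^ (2 * L) * 2 ^ (L * (L + 3))) := by
          gcongr
          exact ih _ (by rw [pow_succ] at hm; omega)
        _ = _ := by ring

theorem sq_lt_mul_two_pow {L : ℕ} (hL : 7 ≤ L) :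
    (4 * L ^ 2 + 24 * L + 26) ^ 2 < 1521 * 2 ^ L := by
  induction L, hL using Nat.le_induction with
  | base => norm_num
  | succ L hL ih =>
    have h : (4 * (L + 1) ^ 2 + 24 * (L + 1) + 26) ^ 2 ≤ 2 * (4 * L ^ 2 + 24 * L + 26) ^ 2 := by
      obtain ⟨k, rfl⟩ := Nat.exists_eq_add_of_le hL
      ring_nf
      gcongr <;> norm_num
    rw [pow_succ (2 : ℕ)]
    omega

theorem two_mul_pow_four_halvingProduct_le {q e : ℕ} (hq : 3 ≤ q) (he : 2 ≤ e) :
    2 * (q ^ 2 * halvingProduct q (e ^ 2)) ^ 4 ≤ q ^ (13 * e) := by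
  obtain h9 | h9 := lt_or_ge e 9
  · have key : ∀ m h L r : ℕ, halvingProduct q m = h * q ^ L → 2 * h ^ 4 ≤ 3 ^ r →
        2 * (q ^ 2 * halvingProduct q m) ^ 4 ≤ q ^ (4 * L + 8 + r) := by
      intro m h L r hf hr
      rw [hf]
      calc 2 * (q ^ 2 * (h * q ^ L)) ^ 4 = q ^ (4 * L + 8) * (2 * h ^ 4) := by ring
        _ ≤ q ^ (4 * L + 8) * q ^ r := by
          gcongr
          exact hr.trans (Nat.pow_le_pow_left hq r)
        _ = _ := by rw [← pow_add]
    interval_cases e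
    · exact key _ 8 2 10 (by norm_num [halvingProduct]; ring) (by norm_num)
    · exact key _ 72 3 19 (by norm_num [halvingProduct]; ring) (by norm_num)
    · exact key _ 1024 4 28 (by norm_num [halvingProduct]; ring) (by norm_num)
    · exact key _ 5400 4 41 (by norm_num [halvingProduct]; ring) (by norm_num)
    · exact key _ (36 * 18 * 9 * 4 * 2) 5 50 (by norm_num [halvingProduct]; ring) (by norm_num)
    · exact key _ (49 * 24 * 12 * 6 * 3) 5 63 (by norm_num [halvingProduct]; ring) (by norm_num)
    · exact key _ (2 ^ 21) 6 72 (by norm_num [halvingProduct]; ring) (by norm_num)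
  · set L := Nat.log 2 (e ^ 2) with hL
    have hle : 2 ^ L ≤ e ^ 2 := Nat.pow_log_le_self 2 (by positivity)
    have hf := halvingProduct_sq_le (by omega : 1 ≤ q) L (e ^ 2)
      (Nat.lt_pow_succ_log_self (by norm_num) _)
    have hexp : 4 * L ^ 2 + 24 * L + 27 ≤ 39 * e := by
      obtain h | h := lt_or_ge L 7
      · nlinarith
      · by_contra! hc
        have h1 := sq_lt_mul_two_pow h
        have h2 : (39 * e) ^ 2 ≤ (4 * L ^ 2 + 24 * L + 26) ^ 2 :=
          Nat.pow_le_pow_left (by omega) 2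
        rw [mul_pow] at h2
        omega
    have h8 : 2 ^ 3 ≤ q ^ 2 := le_trans (by norm_num) (Nat.pow_le_pow_left hq 2)
    have h83 : 2 ^ 3 ≤ q ^ 3 := Nat.pow_le_pow_left (by omega) 3
    refine le_of_pow_le_pow_left₀ (n := 3) (by norm_num) (by positivity) ?_
    calc (2 * (q ^ 2 * halvingProduct q (e ^ 2)) ^ 4) ^ 3
        = 2 ^ 3 * q ^ 24 * (halvingProduct q (e ^ 2) ^ 2) ^ 6 := by ring
      _ ≤ q ^ 3 * q ^ 24 * (q ^ (2 * L) * 2 ^ (L * (L + 3))) ^ 6 := by gcongr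
      _ = q ^ (27 + 12 * L) * (2 ^ 3) ^ (2 * L * (L + 3)) := by
        rw [← pow_mul 2 3]
        ring
      _ ≤ q ^ (27 + 12 * L) * (q ^ 2) ^ (2 * L * (L + 3)) := by gcongr
      _ = q ^ (4 * L ^ 2 + 24 * L + 27) := by ring
      _ ≤ q ^ (39 * e) := Nat.pow_le_pow_right (by omega) hexp
      _ = (q ^ (13 * e)) ^ 3 := by rw [← pow_mul]; ring_nf

theorem sq_mul_halvingProduct_mul_le {q e M m : ℕ} (hq : 2 ≤ q) (he : 1 ≤ e) (hM : M ≤ e ^ 2)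
    (hMq : 2 ≤ M → 3 ≤ q) (hm : m ^ 4 ≤ (q ^ (13 * e)) ^ 3) :
    q ^ 2 * halvingProduct q M * (1024 + m) ≤ q ^ (13 * e) := by
  have hY : q ^ 13 ≤ q ^ (13 * e) := Nat.pow_le_pow_right (by omega) (by omega)
  obtain h | h := lt_or_ge M 2
  · have h1 : halvingProduct q M = 1 := by interval_cases M <;> simp [halvingProduct]
    rw [h1, mul_one]
    obtain ⟨rfl, rfl⟩ | h2 : (q = 2 ∧ e = 1) ∨ 8192 * q ^ 2 ≤ q ^ (13 * e) := by
      obtain rfl | hq := hq.eq_or_lt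
      · obtain rfl | he := he.eq_or_lt
        · exact Or.inl ⟨rfl, rfl⟩
        · exact Or.inr ((by norm_num : 8192 * 2 ^ 2 ≤ 2 ^ 26).trans
            (Nat.pow_le_pow_right (by omega) (by omega)))
      · refine Or.inr (le_trans ?_ hY)
        calc 8192 * q ^ 2 ≤ 3 ^ 11 * q ^ 2 := Nat.mul_le_mul_right _ (by norm_num)
          _ ≤ q ^ 11 * q ^ 2 := by gcongr; omega
          _ = q ^ 13 := by ring
    · have h3 : m ≤ 861 := by
        by_contra! h3
        have := Nat.pow_le_pow_left (show 862 ≤ m from h3) 4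
        omega
      omega
    · refine mul_add_le_of_pow_four_le h2 (le_trans ?_ hY) hm
      calc 2 * (q ^ 2) ^ 4 ≤ q * (q ^ 2) ^ 4 := by gcongr
        _ = q ^ 9 := by ring
        _ ≤ q ^ 13 := Nat.pow_le_pow_right (by omega) (by omega)
  · have hq3 := hMq h
    have he2 : 2 ≤ e := by
      by_contra! h1
      interval_cases e
      omega
    have h2 := two_mul_pow_four_halvingProduct_le hq3 he2
    refine (Nat.mul_le_mul_right _ (Nat.mul_le_mul_left _
      (halvingProduct_mono (by omega) hM))).trans (mul_add_le_of_pow_four_le ?_ h2 hm)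
    refine le_trans ?_ h2
    set Γ := q ^ 2 * halvingProduct q (e ^ 2) with hΓ
    have h16 : 16 ≤ Γ := by
      rw [hΓ, halvingProduct_of_two_le q (by nlinarith)]
      have := one_le_halvingProduct (by omega : 1 ≤ q) (e ^ 2 / 2)
      calc 16 ≤ 3 ^ 2 * (3 * 2 ^ 2 * 1) := by norm_num
        _ ≤ _ := by gcongr
    calc 8192 * Γ = 2 * (16 ^ 3 * Γ) := by ring
      _ ≤ 2 * (Γ ^ 3 * Γ) := by gcongr
      _ = 2 * Γ ^ 4 := by ring

namespace MonoidHom.IsSemilinear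

variable {G F K V : Type*} [Group G] [Field F] [Field K] [Algebra F K] [AddCommGroup V]
  [Module F V] [Module K V] {ρ : G →* Module.End F V}
  {N A : Subgroup G} {ι : A →* K} {σ : G →* (K ≃ₐ[F] K)}

theorem card_le_mul_card_centralizer [Finite K] [Finite G] (h : ρ.IsSemilinear N A ι σ) :
    Nat.card G ≤ Nat.card K * Nat.card (Subgroup.centralizer (A : Set G)) := by
  obtain ⟨θ, hθ⟩ := IsCyclic.exists_generator (α := Kˣ)
  rw [← Subgroup.card_top (G := G)]
  refine Subgroup.card_le_mul_of_separates _ _ le_top (fun g => σ g (θ : K)) fun g k hgk => ?_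
  refine h.mem_centralizer ?_
  have h1 : σ ((g : G)⁻¹ * k) (θ : K) = θ := by
    rw [map_mul, AlgEquiv.mul_apply, ← show σ g (θ : K) = σ k θ from hgk, ← AlgEquiv.mul_apply,
      ← map_mul, inv_mul_cancel, map_one, AlgEquiv.one_apply]
  refine AlgEquiv.ext fun x => ?_
  obtain rfl | hx := eq_or_ne x 0
  · rw [map_zero, map_zero]
  · obtain ⟨n, hn⟩ := Subgroup.mem_zpowers_iff.1 (hθ (Units.mk0 x hx))
    have h2 : x = (θ : K) ^ n := by
      rw [← Units.val_zpow_eq_zpow_val, hn, Units.val_mk0]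
    rw [h2, map_zpow₀, h1, AlgEquiv.one_apply]

theorem card_centralizer_le [IsScalarTower F K V] [Nontrivial V] [Finite K] [Finite G]
    (h : ρ.IsSemilinear N A ι σ) (hAN : A ≤ N) (hA : ∀ a ∈ A, ∀ b ∈ A, a * b = b * a) :
    Nat.card (Subgroup.centralizer
      ((N ⊓ Subgroup.centralizer (A : Set G) : Subgroup G) : Set G)) ≤ Nat.card K := by
  have h1 : ∀ g : Subgroup.centralizer
      ((N ⊓ Subgroup.centralizer (A : Set G) : Subgroup G) : Set G), ∃ k : K, ∀ v,
      ρ g v = k • v := fun g => h.exists_eq_smul_of_commute hAN hA (ρ g) fun c hc => by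
    rw [← map_mul, ← map_mul, Subgroup.mem_centralizer_iff.1 g.2 c hc]
  choose k hk using h1
  refine Nat.card_le_card_of_injective k fun g g' hgg => Subtype.ext (h.injective
    (LinearMap.ext fun v => ?_))
  rw [hk, hk, hgg]

theorem hasRegularTuples [IsScalarTower F K V] [Nontrivial V] [Finite K] [Finite F] [Finite G]
    [FiniteDimensional F V] [FiniteDimensional K V] [N.Normal] [A.Normal]
    (h : ρ.IsSemilinear N A ι σ) (hN : Group.IsNilpotent N) (hAN : A ≤ N)
    (hA : ∀ a ∈ A, ∀ b ∈ A, a * b = b * a)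
    (hmax : ∀ A' : Subgroup G, A'.Normal → A' ≤ N → A ≤ A' →
      (∀ a ∈ A', ∀ b ∈ A', a * b = b * a) → A' ≤ A) : ρ.HasRegularTuples := by
  have hcomm := Subgroup.commutator_mem_of_maximal_abelian hN hAN hA hmax ι h.injective_ι
  have hscalar := h.card_centralizer_le hAN hA
  have hfix : ∀ hCC hZ g, _ := fun hCC hZ g hg =>
    h.four_mul_finrank_fixedSpace_le hAN hA hCC hZ (g := g) hg
  have hAC : A ≤ N ⊓ Subgroup.centralizer (A : Set G) :=
    le_inf hAN fun a ha => Subgroup.mem_centralizer_iff.2 fun b hb => hA b hb a ha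
  set C := N ⊓ Subgroup.centralizer (A : Set G) with hC
  have hcen : ∀ a ∈ A, ∀ b ∈ C, a * b = b * a := fun a ha b hb =>
    Subgroup.mem_centralizer_iff.1 hb.2 a ha
  have hCC : ∀ b ∈ C, ∀ b' ∈ C, ⁅b, b'⁆ ∈ A := fun b hb b' hb' => hcomm b hb b' hb'.1
  have hZ : ∀ b ∈ C, (∀ b' ∈ C, b * b' = b' * b) → b ∈ A := fun b hb hbC =>
    Subgroup.inf_centralizer_le_of_maximal hAC inf_le_left hcen hmax
      ⟨hb, Subgroup.mem_centralizer_iff.2 fun z hz => (hbC z hz).symm⟩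
  set M := Nat.card (C ⧸ A.subgroupOf C) with hM
  have hMe : M ≤ Module.finrank K V ^ 2 := h.card_quotient_le hcen hCC hZ
  have hCcard : Nat.card C = M * Nat.card A := by
    rw [Subgroup.card_eq_card_quotient_mul_card_subgroup (A.subgroupOf C),
      Nat.card_congr (Subgroup.subgroupOfEquivOfLe hAC).toEquiv]
  have hMq : 2 ≤ M → 3 ≤ Nat.card K := by
    intro h2
    obtain ⟨c, hc, hcA⟩ : ∃ c ∈ C, c ∉ A := by
      by_contra! hle
      have h3 := Subgroup.card_le_of_le (show C ≤ A from hle)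
      have h4 : 0 < Nat.card A := Nat.card_pos
      nlinarith
    obtain ⟨d, hd, hcd⟩ : ∃ d ∈ C, c * d ≠ d * c := by
      by_contra! h3
      exact hcA (hZ c hc h3)
    have h3 : ι ⟨⁅c, d⁆, hCC c hc d hd⟩ ≠ 1 := fun h3 => hcd
      (commutatorElement_eq_one_iff_mul_comm.1
        (congrArg Subtype.val (h.injective_ι (h3.trans (map_one ι).symm))))
    have h4 : ι ⟨⁅c, d⁆, hCC c hc d hd⟩ ≠ 0 := ((Group.isUnit _).map ι).ne_zero
    have := Fintype.ofFinite K
    classical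
    rw [Nat.card_eq_fintype_card]
    exact (Finset.card_eq_three.2 ⟨0, 1, _, zero_ne_one, h4.symm, h3.symm, rfl⟩).symm.trans_le
      (Finset.card_le_univ _)
  have hG : Nat.card G ≤ Nat.card K ^ 2 * halvingProduct (Nat.card K) M := by
    refine h.card_le_mul_card_centralizer.trans ?_
    rw [pow_two, mul_assoc]
    refine Nat.mul_le_mul_left _ ?_
    have h1 := Subgroup.card_centralizer_inf_le hAC hcen hCC hZ ι h.injective_ι hscalar M ∅
      (Set.empty_subset _) (by
        rw [← hCcard]
        exact Subgroup.card_le_of_le inf_le_left)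
    refine le_trans (Subgroup.card_le_of_le ?_) h1
    exact le_inf le_rfl fun g _ => Subgroup.mem_centralizer_iff.2 fun x hx => hx.elim
  have : Finite V := Module.finite_of_finite K
  have hV : Nat.card V = Nat.card K ^ Module.finrank K V := Module.natCard_eq_pow_finrank
  have hVF : Nat.card V = Nat.card F ^ Module.finrank F V := Module.natCard_eq_pow_finrank
  have hX : Nat.card (Fin 13 → V) = Nat.card K ^ (13 * Module.finrank K V) := by
    rw [Nat.card_fun, Nat.card_fin, hV, ← pow_mul, mul_comm]
  set m := Nat.sqrt (Nat.sqrt (Nat.card (Fin 13 → V) ^ 3)) with hm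
  have hm4 : m ^ 4 ≤ Nat.card (Fin 13 → V) ^ 3 := by
    calc m ^ 4 = (m ^ 2) ^ 2 := by ring
      _ ≤ (Nat.sqrt (Nat.card (Fin 13 → V) ^ 3)) ^ 2 :=
        Nat.pow_le_pow_left (Nat.sqrt_le' _) 2
      _ ≤ _ := Nat.sqrt_le' _
  have hle_m : ∀ x : ℕ, x ^ 4 ≤ Nat.card (Fin 13 → V) ^ 3 → x ≤ m := fun x hx => by
    rw [hm, Nat.le_sqrt', Nat.le_sqrt', ← pow_mul]
    exact hx
  let _ : MulAction G (Fin 13 → V) :=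
    { smul := fun g x i => ρ g (x i)
      one_smul := fun x => by
        funext i
        change ρ 1 (x i) = x i
        rw [map_one, Module.End.one_apply]
      mul_smul := fun g k x => by
        funext i
        change ρ (g * k) (x i) = ρ g (ρ k (x i))
        rw [map_mul, Module.End.mul_apply] }
  obtain ⟨f, hf⟩ := exists_asymmetric_of_card (H := G) (X := Fin 13 → V) (t := 1024) (m := m)
    (fun g hg => by
      refine hle_m _ ?_
      have hg1 : g ≠ 1 := by
        rintro rfl
        obtain ⟨x, hx⟩ := hg
        exact hx (one_smul _ _)
      have h1 : Nat.card {x : Fin 13 → V // g • x = x} ≤ Nat.card (ρ.fixedSpace g) ^ 13 := by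
        have h2 : Nat.card (Fin 13 → ρ.fixedSpace g) = Nat.card (ρ.fixedSpace g) ^ 13 := by
          rw [Nat.card_fun, Nat.card_fin]
        refine (Nat.card_le_card_of_injective (β := Fin 13 → ρ.fixedSpace g)
          (fun x i => ⟨x.1 i, MonoidHom.mem_fixedSpace.2 (congrFun x.2 i)⟩) fun x y hxy =>
          Subtype.ext (funext fun i => congrArg Subtype.val (congrFun hxy i))).trans_eq h2
      have h2 : Nat.card (ρ.fixedSpace g) ^ 4 ≤ Nat.card V ^ 3 := by
        rw [hVF, Module.natCard_eq_pow_finrank (K := F), ← pow_mul, ← pow_mul, mul_comm _ 4,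
          mul_comm _ 3]
        exact Nat.pow_le_pow_right Nat.card_pos (hfix hCC hZ g hg1)
      calc _ ≤ (Nat.card (ρ.fixedSpace g) ^ 13) ^ 4 := Nat.pow_le_pow_left h1 4
        _ = (Nat.card (ρ.fixedSpace g) ^ 4) ^ 13 := by ring
        _ ≤ (Nat.card V ^ 3) ^ 13 := Nat.pow_le_pow_left h2 13
        _ = Nat.card (Fin 13 → V) ^ 3 := by
          rw [Nat.card_fun, Nat.card_fin]
          ring) (by
      rw [hX] at hm4 ⊢
      refine (Nat.mul_le_mul_right _ hG).trans (sq_mul_halvingProduct_mul_le ?_ ?_ hMe hMq hm4)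
      · exact Finite.one_lt_card
      · exact Module.finrank_pos)
  refine ⟨f, fun a b g hab => ?_⟩
  obtain ⟨h1, h2⟩ := hf a b g (funext hab)
  exact ⟨h1, LinearMap.ext fun v => congrFun (h2 fun _ => v) 0⟩

end MonoidHom.IsSemilinear

theorem MonoidHom.IsAbsIrreducibleOn.hasRegularTuples_of_forall_exists_inverse {F G : Type*}
    {V : Type*} [Field F] [Finite F] [AddCommGroup V] [Module F V] [FiniteDimensional F V]
    [Nontrivial V] [Group G] [Finite G] {ρ : G →* Module.End F V} (hρ : Function.Injective ρ)
    {N A : Subgroup G} [N.Normal] [A.Normal] (hN : ρ.IsAbsIrreducibleOn N)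
    (hNn : Group.IsNilpotent N) (hAN : A ≤ N) (hA : ∀ a ∈ A, ∀ b ∈ A, a * b = b * a)
    (hmax : ∀ A' : Subgroup G, A'.Normal → A' ≤ N → A ≤ A' →
      (∀ a ∈ A', ∀ b ∈ A', a * b = b * a) → A' ≤ A)
    (𝒜 : Subalgebra F (Module.End F V)) (h𝒜 : 𝒜 = Algebra.adjoin F (ρ '' A))
    (hcomm : ∀ x ∈ 𝒜, ∀ y ∈ 𝒜, x * y = y * x)
    (hconj : ∀ g, ∀ x ∈ 𝒜, ρ g * x * ρ g⁻¹ ∈ 𝒜)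
    (hinv : ∀ x ∈ 𝒜, x ≠ 0 → ∃ y ∈ 𝒜, x * y = 1) : ρ.HasRegularTuples := by
  let _ : CommRing 𝒜 := { (inferInstance : Ring 𝒜) with
    mul_comm := fun x y => Subtype.ext (hcomm x x.2 y y.2) }
  have hF : IsField 𝒜 :=
    { exists_pair_ne := ⟨0, 1, zero_ne_one⟩
      mul_comm := mul_comm
      mul_inv_cancel := fun {x} hx => by
        obtain ⟨y, hy, h⟩ := hinv x x.2 fun h => hx (Subtype.ext h)
        exact ⟨⟨y, hy⟩, Subtype.ext h⟩ }
  let _ : Field 𝒜 := hF.toField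
  have hρ1 : ∀ g, ρ g⁻¹ * ρ g = 1 := fun g => by rw [← map_mul, inv_mul_cancel, map_one]
  have hρ2 : ∀ g, ρ g * ρ g⁻¹ = 1 := fun g => by rw [← map_mul, mul_inv_cancel, map_one]
  let c (g : G) : 𝒜 →ₐ[F] 𝒜 :=
    { toFun := fun x => ⟨ρ g * x * ρ g⁻¹, hconj g x x.2⟩
      map_one' := Subtype.ext (by simp [hρ2])
      map_zero' := Subtype.ext (by simp)
      map_add' := fun x y => Subtype.ext (by simp [mul_add, add_mul])
      map_mul' := fun x y => Subtype.ext (by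
        change ρ g * (x * y) * ρ g⁻¹ = ρ g * x * ρ g⁻¹ * (ρ g * y * ρ g⁻¹)
        rw [mul_assoc (ρ g * x), ← mul_assoc (ρ g⁻¹), ← mul_assoc (ρ g⁻¹), hρ1, one_mul]
        simp only [mul_assoc])
      commutes' := fun r => Subtype.ext (by
        change ρ g * algebraMap F _ r * ρ g⁻¹ = algebraMap F _ r
        rw [← Algebra.commutes, mul_assoc, hρ2, mul_one]) }
  have hc1 : c 1 = AlgHom.id F 𝒜 := AlgHom.ext fun x => Subtype.ext (by
    change ρ 1 * x * ρ 1⁻¹ = x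
    rw [inv_one, map_one, one_mul, mul_one])
  have hcmul : ∀ g g', c (g * g') = (c g).comp (c g') := fun g g' =>
    AlgHom.ext fun x => Subtype.ext (by
      change ρ (g * g') * x * ρ (g * g')⁻¹ = ρ g * (ρ g' * x * ρ g'⁻¹) * ρ g⁻¹
      rw [mul_inv_rev, map_mul, map_mul]
      simp only [mul_assoc])
  let σ : G →* (𝒜 ≃ₐ[F] 𝒜) :=
    { toFun := fun g => AlgEquiv.ofAlgHom (c g) (c g⁻¹)
        (by rw [← hcmul, mul_inv_cancel, hc1]) (by rw [← hcmul, inv_mul_cancel, hc1])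
      map_one' := AlgEquiv.ext fun x => AlgHom.congr_fun hc1 x
      map_mul' := fun g g' => AlgEquiv.ext fun x => AlgHom.congr_fun (hcmul g g') x }
  let ι : A →* 𝒜 :=
    { toFun := fun a => ⟨ρ a, h𝒜 ▸ Algebra.subset_adjoin ⟨a, a.2, rfl⟩⟩
      map_one' := Subtype.ext (map_one ρ)
      map_mul' := fun a b => Subtype.ext (map_mul ρ _ _) }
  have h : ρ.IsSemilinear N A ι σ :=
    { injective := hρ
      apply_eq_smul := fun a v => rfl
      apply_smul := fun g k v => by
        change ρ g (k.1 v) = (ρ g * k.1 * ρ g⁻¹) (ρ g v)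
        rw [← Module.End.mul_apply, ← Module.End.mul_apply, mul_assoc, hρ1, mul_one]
      map_smul_of_commute := fun f hf k v => by
        have hk : k.1 ∈ Algebra.adjoin F (ρ '' A) := h𝒜 ▸ k.2
        have := Algebra.commute_of_mem_adjoin_of_forall_mem_commute (a := f) hk (by
          rintro _ ⟨a, ha, rfl⟩
          exact hf a ha)
        exact LinearMap.congr_fun this v
      exists_eq_smul := hN.exists_eq_smul }
  have : Finite V := Module.finite_of_finite F
  have : Finite (Module.End F V) := DFunLike.finite _
  have : FiniteDimensional 𝒜 V := inferInstance
  exact h.hasRegularTuples hNn hAN hA hmax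

theorem Subgroup.isNilpotent_subgroupOf {G : Type*} [Group G] {N : Subgroup G}
    (hN : Group.IsNilpotent N) (H : Subgroup G) : Group.IsNilpotent (N.subgroupOf H) := by
  let f : N.subgroupOf H →* N :=
    { toFun := fun x => ⟨x.1, x.2⟩
      map_one' := rfl
      map_mul' := fun _ _ => rfl }
  refine Subgroup.isNilpotent_of_ker_le_center f ?_
  have hf : Function.Injective f := fun x y hxy => by
    have h : (x : H).1 = (y : H).1 := congrArg (fun z : N => (z : G)) hxy
    exact Subtype.ext (Subtype.ext h)
  rw [(MonoidHom.ker_eq_bot_iff f).2 hf]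
  exact bot_le

/-- A maximal abelian normal subgroup contained in `N`. -/
theorem Subgroup.exists_maximal_abelian_normal {G : Type*} [Group G] [Finite G] (N : Subgroup G) :
    ∃ A : Subgroup G, A.Normal ∧ A ≤ N ∧ (∀ a ∈ A, ∀ b ∈ A, a * b = b * a) ∧
      ∀ A' : Subgroup G, A'.Normal → A' ≤ N → A ≤ A' →
        (∀ a ∈ A', ∀ b ∈ A', a * b = b * a) → A' ≤ A := by
  obtain ⟨A, -, ⟨h1, h2, h3⟩, hA⟩ := Finite.exists_le_maximal (a := (⊥ : Subgroup G))
    (p := fun A : Subgroup G => A.Normal ∧ A ≤ N ∧ ∀ a ∈ A, ∀ b ∈ A, a * b = b * a)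
    ⟨inferInstance, bot_le, fun a ha b hb => by
      rw [Subgroup.mem_bot.1 ha, Subgroup.mem_bot.1 hb]⟩
  exact ⟨A, h1, h2, h3, fun A' h1' h2' hle h3' => hA ⟨h1', h2', h3'⟩ hle⟩

namespace MonoidHom.IsAbsIrreducibleOn

theorem hasRegularTuples_of_injective {F : Type*} {V G : Type u} [Field F] [Finite F]
    [AddCommGroup V] [Module F V] [FiniteDimensional F V] [Nontrivial V] [Group G] [Finite G]
    {ρ : G →* Module.End F V} (hρ : Function.Injective ρ) {N : Subgroup G} [N.Normal]
    (hN : ρ.IsAbsIrreducibleOn N) (hNn : Group.IsNilpotent N)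
    (ih : ∀ (W H : Type u) [AddCommGroup W] [Module F W] [FiniteDimensional F W] [Nontrivial W]
      [Group H] (τ : H →* Module.End F W) (M : Subgroup H) [M.Normal],
      Module.finrank F W < Module.finrank F V → τ.IsAbsIrreducibleOn M → Group.IsNilpotent M →
      τ.HasRegularTuples) : ρ.HasRegularTuples := by
  obtain ⟨A, hAn, hAN, hA, hmax⟩ := N.exists_maximal_abelian_normal
  have hcomm : ∀ x ∈ Algebra.adjoin F (ρ '' A), ∀ y ∈ Algebra.adjoin F (ρ '' A),
      x * y = y * x := by
    refine fun x hx y hy => Algebra.commute_of_mem_adjoin_of_forall_mem_commute hy ?_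
    rintro _ ⟨b, hb, rfl⟩
    refine (Algebra.commute_of_mem_adjoin_of_forall_mem_commute hx ?_).symm
    rintro _ ⟨a, ha, rfl⟩
    rw [commute_iff_eq, ← map_mul, ← map_mul, hA b hb a ha]
  have hconj : ∀ g, ∀ x ∈ Algebra.adjoin F (ρ '' A),
      ρ g * x * ρ g⁻¹ ∈ Algebra.adjoin F (ρ '' A) := by
    intro g x hx
    have h1 : ρ g⁻¹ * ρ g = 1 := by rw [← map_mul, inv_mul_cancel, map_one]
    have h2 : ρ g * ρ g⁻¹ = 1 := by rw [← map_mul, mul_inv_cancel, map_one]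
    induction hx using Algebra.adjoin_induction with
    | mem x hx =>
      obtain ⟨a, ha, rfl⟩ := hx
      rw [← map_mul, ← map_mul]
      exact Algebra.subset_adjoin ⟨_, hAn.conj_mem a ha g, rfl⟩
    | algebraMap r =>
      rw [← Algebra.commutes, mul_assoc, h2, mul_one]
      exact Subalgebra.algebraMap_mem _ r
    | add x y _ _ hx hy =>
      rw [mul_add, add_mul]
      exact add_mem hx hy
    | mul x y _ _ hx hy =>
      have h : ρ g * (x * y) * ρ g⁻¹ = ρ g * x * ρ g⁻¹ * (ρ g * y * ρ g⁻¹) := by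
        rw [mul_assoc (ρ g * x), ← mul_assoc (ρ g⁻¹), ← mul_assoc (ρ g⁻¹), h1, one_mul]
        simp only [mul_assoc]
      rw [h]
      exact mul_mem hx hy
  rcases hN.exists_inverse_or_exists_isImprimitivitySystem hcomm hconj with
    hinv | ⟨J, _, _, _, π, hπ⟩
  · exact hN.hasRegularTuples_of_forall_exists_inverse hρ hNn hAN hA hmax _ rfl hcomm hconj hinv
  · obtain ⟨j⟩ : Nonempty J := inferInstance
    have : Nontrivial (LinearMap.range (π j)) :=
      Submodule.nontrivial_iff_ne_bot.2 fun h => hπ.ne_zero j (LinearMap.range_eq_bot.1 h)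
    exact hπ.hasRegularTuples hNn hN j (ih _ _ _ (N.subgroupOf (MulAction.stabilizer G j))
      (hπ.finrank_range_lt j) (hπ.isAbsIrreducibleOn_blockRep hN j)
      (Subgroup.isNilpotent_subgroupOf hNn _))

theorem hasRegularTuples {F : Type*} {V G : Type u} [Field F] [Finite F] [AddCommGroup V]
    [Module F V] [FiniteDimensional F V] [Nontrivial V] [Group G] {ρ : G →* Module.End F V}
    {N : Subgroup G} [N.Normal] (hN : ρ.IsAbsIrreducibleOn N) (hNn : Group.IsNilpotent N) :
    ρ.HasRegularTuples := by
  induction hn : Module.finrank F V using Nat.strong_induction_on generalizing V G with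
  | _ n ih =>
  have : Finite V := Module.finite_of_finite F
  have : Finite (Module.End F V) := DFunLike.finite _
  let φ : G →* ρ.toHomUnits.range := ρ.toHomUnits.rangeRestrict
  have hφ : Function.Surjective φ := ρ.toHomUnits.rangeRestrict_surjective
  let τ : ρ.toHomUnits.range →* Module.End F V :=
    (Units.coeHom (Module.End F V)).comp (Subgroup.subtype _)
  have hτ : Function.Injective τ := fun x y h => Subtype.ext (Units.ext h)
  have hτφ : ∀ g, τ (φ g) = ρ g := fun g => rfl
  have : (N.map φ).Normal := Subgroup.Normal.map inferInstance φ hφ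
  have hnil : Group.IsNilpotent (N.map φ) :=
    Group.nilpotent_of_surjective (φ.subgroupMap N) (φ.subgroupMap_surjective N)
  have hirr : τ.IsAbsIrreducibleOn (N.map φ) :=
    ⟨fun W hW => hN.eq_bot_or_eq_top W fun n hn => hW (φ n) ⟨n, hn, rfl⟩,
      fun f hf => hN.exists_eq_smul f fun n hn => hf (φ n) ⟨n, hn, rfl⟩⟩
  obtain ⟨f, hf⟩ := hirr.hasRegularTuples_of_injective hτ hnil
    fun W H _ _ _ _ _ τ M _ hlt hM hMn => ih _ (hn ▸ hlt) hM hMn rfl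
  exact ⟨f, fun a b g => hf a b (φ g)⟩

end MonoidHom.IsAbsIrreducibleOn

/-- Let `F` be a finite field, `V` a nonzero finite-dimensional
`F`-vector space and `G ≤ GL(V)`. If `G` has a nilpotent normal subgroup `N` acting
absolutely irreducibly on `V`, then `b_V(G) ≤ 13`. -/
theorem base_size_nilpotent_absolutely_irreducible {F V : Type*} [Field F] [Fintype F]
    [AddCommGroup V] [Module F V] [FiniteDimensional F V] [Nontrivial V]
    (G N : Subgroup (V ≃ₗ[F] V)) (hNG : N ≤ G)
    (hnormal : ∀ g ∈ G, ∀ n ∈ N, g * n * g⁻¹ ∈ N)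
    (hnilpotent : Group.IsNilpotent N)
    (hirr : ∀ W : Submodule F V,
      (∀ h ∈ N, W.map (h : V →ₗ[F] V) = W) → W = ⊥ ∨ W = ⊤)
    (habs : ∀ f : V →ₗ[F] V, (∀ h ∈ N, ∀ v, f (h v) = h (f v)) →
      ∃ c : F, f = c • LinearMap.id) :
    sInf {k : ℕ | ∃ B : Finset V, B.card = k ∧
        ∀ g ∈ G, (∀ v ∈ B, g v = v) → g = 1} ≤ 13 := by
  classical
  let ρ : G →* Module.End F V :=
    { toFun := fun g => (g : V ≃ₗ[F] V)
      map_one' := rfl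
      map_mul' := fun _ _ => rfl }
  have : (N.subgroupOf G).Normal := ⟨fun n hn g => hnormal g g.2 n hn⟩
  have hρ : ρ.IsAbsIrreducibleOn (N.subgroupOf G) := by
    refine ⟨fun W hW => hirr W fun h hh => le_antisymm ?_ fun w hw => ?_, fun f hf => ?_⟩
    · rintro _ ⟨w, hw, rfl⟩
      exact hW ⟨h, hNG hh⟩ hh w hw
    · exact ⟨h⁻¹ w, hW ⟨h⁻¹, hNG (inv_mem hh)⟩ (inv_mem hh) w hw, h.apply_symm_apply w⟩
    · exact habs f fun h hh v => LinearMap.congr_fun (hf ⟨h, hNG hh⟩ hh) v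
  obtain ⟨f, hf⟩ := hρ.hasRegularTuples (Subgroup.isNilpotent_subgroupOf hnilpotent G)
  refine le_trans (Nat.sInf_le (m := (Finset.univ.image (f 0)).card)
    ⟨Finset.univ.image (f 0), rfl, fun g hg hfix => ?_⟩)
    (Finset.card_image_le.trans_eq (Finset.card_fin 13))
  have h1 : ρ ⟨g, hg⟩ = 1 := (hf 0 0 ⟨g, hg⟩ fun i =>
    hfix _ (Finset.mem_image_of_mem _ (Finset.mem_univ i))).2
  exact LinearEquiv.toLinearMap_injective h1
end

section
/- Let F be a finite field, let K be a subfield of F with [F : K] = r (F has dimension r as a K-vector space), let d ≥ 1, and let M be the subgroup of GL_d(F) consisting of all matrices of the form λ·A where λ ∈ F^× and A is an invertible d×d matrix all of whose entries lie in K. Then for the natural action of M on V = F^d there is a base of size at most d/r + 2; that is, there exist vectors v₁,…,v_s ∈ F^d with s ≤ d/r + 2 such that the only element of M fixing each v_i is the identity. -/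
/-- Let `F` be a finite field, `K ⊆ F` a subfield with `[F : K] = r`,
and let `M ≤ GL_d(F)` consist of the matrices `λ • A` with `λ ∈ F^×` and `A` an
invertible matrix with entries in `K`. Then `M` has a base of size at most `d/r + 2` on
`F^d`. -/
theorem base_size_scalars_times_subfield_group (F : Type*) [Field F] [Fintype F]
    (K : Subfield F) (r : ℕ) (hr : Module.finrank K F = r) (d : ℕ) (hd : 1 ≤ d) :
    ∃ (s : ℕ) (v : Fin s → (Fin d → F)),
      (s : ℝ) ≤ (d : ℝ) / r + 2 ∧
      ∀ B : Matrix (Fin d) (Fin d) F,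
        (∃ (c : F) (A : Matrix (Fin d) (Fin d) F),
          c ≠ 0 ∧ (∀ i j, A i j ∈ K) ∧ IsUnit A ∧ B = c • A) →
        (∀ i, B.mulVec (v i) = v i) → B = 1 := by
  classical
  have hr_pos : 0 < r := hr ▸ Module.finrank_pos
  obtain ⟨w, hw⟩ : ∃ w : Fin d → (Fin (d / r + 1) → F), LinearIndependent K w := by
    have hle : d ≤ Module.finrank K (Fin (d / r + 1) → F) := by
      rw [Module.finrank_pi_fintype]
      simp only [hr, Finset.sum_const, Finset.card_univ, Fintype.card_fin, smul_eq_mul]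
      exact (Nat.lt_mul_of_div_lt (Nat.lt_succ_self _) hr_pos).le
    exact ⟨_, (Module.finBasis K (Fin (d / r + 1) → F)).linearIndependent.comp
      (Fin.castLE hle) (Fin.castLE_injective hle)⟩
  let i₀ : Fin d := ⟨0, hd⟩
  refine ⟨d / r + 1 + 1, Fin.cons (Pi.single i₀ 1) fun k j => w j k, ?_, ?_⟩
  · have := Nat.cast_div_le (α := ℝ) (m := d) (n := r)
    push_cast
    linarith
  rintro B ⟨c, A, hc, hA, -, rfl⟩ hB
  have hcA : c * A i₀ i₀ = 1 := by
    simpa using congrFun (hB 0) i₀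
  have hcK : c ∈ K := eq_inv_of_mul_eq_one_left hcA ▸ K.inv_mem (hA i₀ i₀)
  have hBK (i j : Fin d) : (c • A - 1) i j ∈ K := by
    have h_one : (1 : Matrix (Fin d) (Fin d) F) i j ∈ K := by
      rw [Matrix.one_apply]
      split_ifs
      exacts [K.one_mem, K.zero_mem]
    exact K.sub_mem (K.mul_mem hcK (hA i j)) h_one
  rw [← sub_eq_zero]
  ext i j
  have h_sum : ∑ j, (⟨(c • A - 1) i j, hBK i j⟩ : K) • w j = 0 := by
    ext k
    have h_fix : ((c • A - 1).mulVec fun j => w j k) i = 0 := by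
      have h := hB k.succ
      rw [Fin.cons_succ] at h
      rw [Matrix.sub_mulVec, h, Matrix.one_mulVec, sub_self, Pi.zero_apply]
    rw [Finset.sum_apply]
    exact h_fix
  exact congrArg Subtype.val (Fintype.linearIndependent_iff.mp hw _ h_sum j)
end

section
/- Let F be a finite field, let V₁ and V₂ be finite-dimensional F-vector spaces with dim V₁ = n₁ ≤ n₂ = dim V₂, and let H₁ ≤ GL(V₁), H₂ ≤ GL(V₂). Let b*(H₂) denote the smallest size of a strong base for H₂, i.e. of a set B ⊆ V₂ such that every h ∈ H₂ with the property that h(v) is a scalar multiple of v for each v ∈ B is itself a scalar transformation of V₂. If n₁ ≤ b*(H₂), then there exists a set C ⊆ V₁ ⊗_F V₂ with |C| ≤ b*(H₂)/n₁ + 3 such that for all h₁ ∈ H₁ and h₂ ∈ H₂, if the tensor product map h₁ ⊗ h₂ fixes every element of C, then h₁ ⊗ h₂ is the identity on V₁ ⊗_F V₂. -/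
open TensorProduct

/-- If `h₁ ⊗ h₂` fixes `∑ eᵢ ⊗ vᵢ`, then `h₂` acts on the family `v` through the matrix of
`h₁⁻¹` in the basis `e`. -/
lemma apply_eq_sum_of_map_fixes {F V₁ V₂ ι : Type*} [Field F] [Fintype ι]
    [AddCommGroup V₁] [Module F V₁] [AddCommGroup V₂] [Module F V₂]
    (e : Module.Basis ι F V₁) (h₁ : V₁ ≃ₗ[F] V₁) (h₂ : V₂ ≃ₗ[F] V₂) (v : ι → V₂)
    (hv : TensorProduct.map (h₁ : V₁ →ₗ[F] V₁) (h₂ : V₂ →ₗ[F] V₂) (∑ i, e i ⊗ₜ[F] v i) =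
      ∑ i, e i ⊗ₜ[F] v i) (k : ι) :
    h₂ (v k) = ∑ i, e.repr (h₁.symm (e i)) k • v i := by
  classical
  have h := congrArg (fun x => TensorProduct.lid F V₂ (TensorProduct.map
    ((e.coord k).comp (h₁.symm : V₁ →ₗ[F] V₁)) LinearMap.id x)) hv
  simpa [map_sum, Finsupp.single_apply, ite_smul] using h

/-- A square matrix commuting, through the action of `h`, with the shift of a linearly independent
family `w`, and such that `h` scales `w 0` by the last diagonal entry, is scalar. -/
lemma apply_eq_smul_of_shift {F V : Type*} [Field F] [AddCommGroup V] [Module F V] {n : ℕ}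
    (w : Fin n → V) (hw : LinearIndependent F w) (h : V →ₗ[F] V) (M : Fin n → Fin n → F)
    (l : F) (h0 : ∀ k, h (w k) = ∑ i, M k i • w i)
    (h1 : ∀ (k : Fin n) (hk : k.1 + 1 < n), h (w ⟨k.1 + 1, hk⟩) =
      ∑ i : Fin n, M k i • (if hi : i.1 + 1 < n then w ⟨i.1 + 1, hi⟩ else 0))
    (hl : ∀ hn : 0 < n, h (w ⟨0, hn⟩) = l • w ⟨0, hn⟩) (k i : Fin n) :
    M k i = if i = k then l else 0 := by
  have key : ∀ k : Fin n, h (w k) = l • w k → ∀ i, M k i = if i = k then l else 0 := by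
    intro k hk i
    have hs : ∑ i, M k i • w i = ∑ i, (if i = k then l else 0) • w i := by
      rw [← h0, hk]; simp
    exact congrFun (hw.fintypeLinearCombination_injective (a₁ := M k) hs) i
  have scale : ∀ (m : ℕ) (hm : m < n), h (w ⟨m, hm⟩) = l • w ⟨m, hm⟩ := by
    intro m
    induction m with
    | zero => exact hl
    | succ m ih =>
      intro hm
      have hM := key _ (ih (by omega))
      rw [h1 ⟨m, by omega⟩ hm]
      rw [Finset.sum_eq_single ⟨m, by omega⟩ (fun i _ hi => by rw [hM, if_neg hi, zero_smul])
        (by simp)]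
      simp [hM, hm]
  exact key k (scale k k.2) i

/-- Let `V₁, V₂` be finite-dimensional `F`-vector spaces with
`dim V₁ = n₁ ≤ n₂ = dim V₂`, `H₁ ≤ GL(V₁)`, `H₂ ≤ GL(V₂)`, and let `b*(H₂)` be the
minimal size of a strong base for `H₂`. If `n₁ ≤ b*(H₂)`, then there is a set
`C ⊆ V₁ ⊗ V₂` of size at most `b*(H₂)/n₁ + 3` such that any `h₁ ⊗ h₂` (with
`h₁ ∈ H₁, h₂ ∈ H₂`) fixing `C` pointwise is the identity on `V₁ ⊗ V₂`. -/
theorem base_size_tensor_product {F V₁ V₂ : Type*} [Field F] [Fintype F]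
    [AddCommGroup V₁] [Module F V₁] [FiniteDimensional F V₁]
    [AddCommGroup V₂] [Module F V₂] [FiniteDimensional F V₂]
    (n₁ n₂ : ℕ) (h₁dim : Module.finrank F V₁ = n₁) (h₂dim : Module.finrank F V₂ = n₂)
    (hn : n₁ ≤ n₂)
    (H₁ : Subgroup (V₁ ≃ₗ[F] V₁)) (H₂ : Subgroup (V₂ ≃ₗ[F] V₂))
    (bstar : ℕ)
    (hbstar : bstar = sInf {k : ℕ | ∃ B : Finset V₂, B.card = k ∧
      ∀ h ∈ H₂, (∀ v ∈ B, ∃ c : F, h v = c • v) → ∃ c : F, ∀ w, h w = c • w})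
    (hle : n₁ ≤ bstar) :
    ∃ C : Finset (V₁ ⊗[F] V₂), (C.card : ℝ) ≤ (bstar : ℝ) / n₁ + 3 ∧
      ∀ h₁ ∈ H₁, ∀ h₂ ∈ H₂,
        (∀ x ∈ C, TensorProduct.map (h₁ : V₁ →ₗ[F] V₁) (h₂ : V₂ →ₗ[F] V₂) x = x) →
        TensorProduct.map (h₁ : V₁ →ₗ[F] V₁) (h₂ : V₂ →ₗ[F] V₂) = LinearMap.id := by
  rcases Nat.eq_zero_or_pos n₁ with rfl | hpos
  · have : Subsingleton V₁ := Module.finrank_zero_iff.1 h₁dim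
    refine ⟨∅, by simp, fun h₁ _ h₂ _ _ => TensorProduct.ext' fun x y => ?_⟩
    simp [Subsingleton.elim x 0]
  have hne := Nat.nonempty_of_pos_sInf (hbstar ▸ hpos.trans_le hle)
  obtain ⟨B, hBcard, hB⟩ := hbstar ▸ Nat.sInf_mem hne
  classical
  let e : Module.Basis (Fin n₁) F V₁ := Module.finBasisOfFinrankEq F V₁ h₁dim
  let w : Fin n₁ → V₂ := fun i => Module.finBasisOfFinrankEq F V₂ h₂dim (Fin.castLE hn i)
  have hw : LinearIndependent F w :=
    (Module.finBasisOfFinrankEq F V₂ h₂dim).linearIndependent.comp _ (Fin.castLE_injective hn)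
  let T : (Fin n₁ → V₂) → V₁ ⊗[F] V₂ := fun v => ∑ i, e i ⊗ₜ[F] v i
  let s : Fin n₁ → V₂ := fun i => if hi : i.1 + 1 < n₁ then w ⟨i.1 + 1, hi⟩ else 0
  let β : ℕ → V₂ := fun k => if hk : k < B.card then B.equivFin.symm ⟨k, hk⟩ else w ⟨0, hpos⟩
  let y : ℕ → Fin n₁ → V₂ := fun j i => β (n₁ * j + i)
  refine ⟨insert (T w) (insert (T s) ((Finset.range (bstar / n₁ + 1)).image fun j => T (y j))),
    ?_, fun h₁ _ h₂ hh₂ hfix => ?_⟩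
  · have h1 : (insert (T w) (insert (T s)
        ((Finset.range (bstar / n₁ + 1)).image fun j => T (y j)))).card ≤ bstar / n₁ + 3 := by
      refine (Finset.card_insert_le _ _).trans (Nat.succ_le_succ ?_)
      refine (Finset.card_insert_le _ _).trans (Nat.succ_le_succ ?_)
      exact Finset.card_image_le.trans (by simp)
    calc _ ≤ ((bstar / n₁ + 3 : ℕ) : ℝ) := by exact_mod_cast h1
      _ ≤ _ := by push_cast; gcongr; exact Nat.cast_div_le
  set M : Fin n₁ → Fin n₁ → F := fun k i => e.repr (h₁.symm (e i)) k with hM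
  have hTw := apply_eq_sum_of_map_fixes e h₁ h₂ w (hfix _ (by simp [T]))
  have hTs := apply_eq_sum_of_map_fixes e h₁ h₂ s (hfix _ (by simp [T]))
  have hTy : ∀ j ≤ bstar / n₁, ∀ k, h₂ (y j k) = ∑ i, M k i • y j i := fun j hj =>
    apply_eq_sum_of_map_fixes e h₁ h₂ (y j) (hfix _ (Finset.mem_insert_of_mem
      (Finset.mem_insert_of_mem (Finset.mem_image_of_mem _ (by simpa [Nat.lt_succ_iff] using hj)))))
  let z : Fin n₁ := ⟨n₁ - 1, by omega⟩
  have hz : ∀ i, i ≠ z → M z i = 0 := by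
    intro i hi
    have hi' : i.1 + 1 < n₁ := by
      have : i.1 ≠ n₁ - 1 := fun h => hi (Fin.ext h)
      omega
    have h := hTs z
    have hsz : s z = 0 := dif_neg (by simp only [z]; omega)
    rw [hsz, map_zero] at h
    have hlin := Fintype.linearIndependent_iff.1 hw
      (fun j => if hj : 0 < j.1 then M z ⟨j.1 - 1, by omega⟩ else 0) ?_ ⟨i.1 + 1, hi'⟩
    · simpa using hlin
    · obtain ⟨m, rfl⟩ : ∃ m, n₁ = m + 1 := ⟨n₁ - 1, by omega⟩
      rw [Fin.sum_univ_castSucc] at h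
      rw [Fin.sum_univ_succ]
      simpa [s, M, Fin.succ, Fin.castSucc, Fin.castAdd, Fin.castLE] using h.symm
  have hyz : y (bstar / n₁) z = w ⟨0, hpos⟩ := by
    refine dif_neg ?_
    have h1 := Nat.div_add_mod bstar n₁
    have h2 := Nat.mod_lt bstar hpos
    simp only [z]
    omega
  have hlast : h₂ (w ⟨0, hpos⟩) = M z z • w ⟨0, hpos⟩ := by
    rw [← hyz, hTy _ le_rfl z]
    exact Finset.sum_eq_single z (fun i _ hi => by rw [hz i hi, zero_smul]) (by simp)
  generalize M z z = l at hlast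
  have hscalar : ∀ k i, M k i = if i = k then l else 0 :=
    apply_eq_smul_of_shift w hw (h₂ : V₂ →ₗ[F] V₂) M l hTw
      (fun k hk => by simpa [s, hk] using hTs k) (fun _ => hlast)
  obtain ⟨c, hc⟩ := hB h₂ hh₂ fun v hv => by
    refine ⟨l, ?_⟩
    let t := B.equivFin ⟨v, hv⟩
    have hyt : y (t.1 / n₁) ⟨t.1 % n₁, Nat.mod_lt _ hpos⟩ = v := by
      simp [y, β, Nat.div_add_mod, t]
    have h := hTy (t.1 / n₁) (Nat.div_le_div_right (by omega)) ⟨t.1 % n₁, Nat.mod_lt _ hpos⟩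
    simpa [hscalar, hyt] using h
  have hcl : c = l := by
    rw [hc] at hlast
    exact smul_left_injective F (hw.ne_zero _) hlast
  have hinv : ∀ x, h₁.symm x = c • x := by
    have h : (h₁.symm : V₁ →ₗ[F] V₁) = c • LinearMap.id := e.ext fun i => e.repr.injective <| by
      ext k
      have := hscalar k i
      simp only [hM] at this
      simp [this, ← hcl, Finsupp.single_apply]
    exact fun x => LinearMap.congr_fun h x
  refine TensorProduct.ext' fun x v => ?_
  have hx : c • h₁ x = x := by rw [← hinv, h₁.symm_apply_apply]
  simp only [TensorProduct.map_tmul, LinearEquiv.coe_coe, LinearMap.id_apply, hc]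
  rw [← TensorProduct.smul_tmul, hx]
end
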